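/- arXiv:1008.0723 — 2 statements merged into one kernel-verified Lean document; each statement's English description precedes it below -/
import Mathlib

section
/- Let ε ∈ (0,1] be a real number. There exist a positive integer p₀, a real δ > 0, and constants c > 0, C > 0 (all depending only on ε) such that for every prime p ≥ p₀ and every multiplicative subgroup R of F_p* with p^ε ≤ |R| ≤ c·p^{2/3}, both |R − R| ≥ C·min{ |R|·p^{1/3}·(log |R|)^{−1/3}, |R|^{3/2}·p^δ } and |R + R| ≥ C·min{ |R|·p^{1/3}·(log |R|)^{−1/3}, |R|^{3/2}·p^δ }. -/
open Finset Pointwise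

/-- `R` is (the image in `F_p` of) a multiplicative subgroup of `F_p^*`. -/
def IsMulSubgroup (p : ℕ) (R : Finset (ZMod p)) : Prop :=
  ∃ H : Subgroup (ZMod p)ˣ, (R : Set (ZMod p)) = Units.val '' (H : Set (ZMod p)ˣ)

section Stepanov
open Polynomial

/-- A nonzero polynomial of degree `< p` with at most `n` terms is not divisible by `(X-1)^n`. -/
lemma sparse_not_dvd {p : ℕ} [Fact p.Prime] (n : ℕ) :
    ∀ P : (ZMod p)[X], P ≠ 0 → P.natDegree < p → P.support.card ≤ n → ¬ (X - C 1) ^ n ∣ P := by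
  induction n with
  | zero =>
    intro P h0 _ hs
    exact absurd (by simpa using hs) h0
  | succ n ih =>
    intro P h0 hd hs hdvd
    set d := P.natDegree with hdd
    set Q : (ZMod p)[X] := X * derivative P - C (d : ZMod p) * P with hQ
    have hcoef : ∀ e, Q.coeff e = ((e : ZMod p) - d) * P.coeff e := by
      intro e
      rw [hQ, coeff_sub, coeff_C_mul]
      cases e with
      | zero => simp
      | succ e =>
        rw [coeff_X_mul, coeff_derivative]
        push_cast
        ring
    have hQdvd : (X - C 1) ^ n ∣ Q := by
      obtain ⟨G, hG⟩ := hdvd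
      have : (X - C 1 : (ZMod p)[X]) ^ n ∣ derivative P := by
        rw [hG, derivative_mul, derivative_X_sub_C_pow]
        simp only [Nat.add_sub_cancel]
        refine dvd_add ?_ ?_
        · exact Dvd.dvd.mul_right (Dvd.dvd.mul_left (dvd_refl _) _) _
        · exact Dvd.dvd.mul_right (pow_dvd_pow _ (Nat.le_succ n)) _
      refine dvd_sub (Dvd.dvd.mul_left this _) (Dvd.dvd.mul_left ?_ _)
      exact (pow_dvd_pow _ (Nat.le_succ n)).trans ⟨G, hG⟩
    have hsub : Q.support ⊆ P.support.erase d := by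
      intro e he
      rw [mem_support_iff, hcoef] at he
      rw [Finset.mem_erase, mem_support_iff]
      refine ⟨?_, right_ne_zero_of_mul he⟩
      rintro rfl
      simp at he
    have hQcard : Q.support.card ≤ n := by
      have h1 := Finset.card_le_card hsub
      have h2 : d ∈ P.support := natDegree_mem_support_of_nonzero h0
      rw [Finset.card_erase_of_mem h2] at h1
      omega
    by_cases hQ0 : Q = 0
    · -- P is a monomial
      have hP : P = monomial d (P.coeff d) := by
        ext e
        rw [coeff_monomial]
        split_ifs with h
        · rw [h]
        · have := hcoef e
          rw [hQ0, coeff_zero] at this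
          rcases mul_eq_zero.mp this.symm with h1 | h1
          · by_cases hc : P.coeff e = 0
            · exact hc
            · exfalso
              have hle : e ≤ d := le_natDegree_of_ne_zero hc
              apply h
              have h3 : ((e : ℕ) : ZMod p) = (d : ℕ) := sub_eq_zero.mp h1
              rw [ZMod.natCast_eq_natCast_iff'] at h3
              rw [Nat.mod_eq_of_lt hd, Nat.mod_eq_of_lt (by omega)] at h3
              exact h3.symm
          · exact h1
      have hr : (X - C 1 : (ZMod p)[X]) ∣ P := (dvd_pow_self _ (Nat.succ_ne_zero n)).trans hdvd
      rw [dvd_iff_isRoot, IsRoot.def, hP, eval_monomial] at hr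
      simp only [one_pow, mul_one] at hr
      exact h0 (leadingCoeff_eq_zero.mp hr)
    · refine ih Q hQ0 ?_ hQcard hQdvd
      refine lt_of_le_of_lt ?_ hd
      refine natDegree_le_iff_coeff_eq_zero.mpr ?_
      intro N hN
      rw [hcoef, coeff_eq_zero_of_natDegree_lt hN, mul_zero]

/-- the operator `X(1-X) d/dX` -/
noncomputable def theta (p : ℕ) : (ZMod p)[X] →ₗ[ZMod p] (ZMod p)[X] :=
  (LinearMap.mulLeft (ZMod p) (X * (1 - X))).comp derivative

lemma theta_apply {p : ℕ} (f : (ZMod p)[X]) : theta p f = X * (1 - X) * derivative f := rfl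

lemma theta_iter_ne {p : ℕ} [Fact p.Prime] (x : ZMod p) (hx0 : x ≠ 0) (hx1 : x ≠ 1) (r : ℕ) :
    r < p → ∀ g : (ZMod p)[X], g.eval x ≠ 0 →
      (((theta p)^[r]) ((X - C x) ^ r * g)).eval x ≠ 0 := by
  induction r with
  | zero => intro _ g hg; simpa using hg
  | succ r ih =>
    intro hr g hg
    rw [Function.iterate_succ_apply]
    have : theta p ((X - C x) ^ (r + 1) * g) =
        (X - C x) ^ r * (C ((r + 1 : ℕ) : ZMod p) * X * (1 - X) * g +
          (X - C x) * (X * (1 - X) * derivative g)) := by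
      rw [theta_apply, derivative_mul, derivative_X_sub_C_pow]
      simp only [Nat.add_sub_cancel, map_natCast]
      ring
    rw [this]
    apply ih (by omega)
    simp only [eval_add, eval_mul, eval_C, eval_X, eval_sub, eval_one, sub_self, zero_mul, add_zero]
    refine mul_ne_zero (mul_ne_zero (mul_ne_zero ?_ hx0) (sub_ne_zero.mpr (Ne.symm hx1))) hg
    rw [Ne, ZMod.natCast_eq_zero_iff]
    intro h
    exact absurd (Nat.le_of_dvd (Nat.succ_pos r) h) (by omega)

lemma le_rootMult {p : ℕ} [Fact p.Prime] (x : ZMod p) (hx0 : x ≠ 0) (hx1 : x ≠ 1) (M : ℕ)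
    (hM : M ≤ p) (f : (ZMod p)[X]) (hf : f ≠ 0)
    (h : ∀ m < M, (((theta p)^[m]) f).eval x = 0) : M ≤ f.rootMultiplicity x := by
  by_contra hlt
  push Not at hlt
  obtain ⟨g, hg, hg2⟩ := exists_eq_pow_rootMultiplicity_mul_and_not_dvd f hf x
  have := theta_iter_ne x hx0 hx1 (f.rootMultiplicity x) (by omega) g
    (by rwa [dvd_iff_isRoot, IsRoot.def] at hg2)
  rw [← hg] at this
  exact this (h _ hlt)

/-- twisted operator -/
noncomputable def thetaT (p n m : ℕ) : (ZMod p)[X] →ₗ[ZMod p] (ZMod p)[X] :=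
  theta p + LinearMap.mulLeft (ZMod p) ((n : (ZMod p)[X]) * (1 - X) - (m : (ZMod p)[X]) * X)

lemma thetaT_apply {p : ℕ} (n m : ℕ) (f : (ZMod p)[X]) :
    thetaT p n m f = X * (1 - X) * derivative f + ((n : (ZMod p)[X]) * (1 - X) - (m : (ZMod p)[X]) * X) * f := rfl

lemma theta_twist {p : ℕ} (n m : ℕ) (f : (ZMod p)[X]) :
    theta p (f * (X ^ n * (1 - X) ^ m)) = thetaT p n m f * (X ^ n * (1 - X) ^ m) := by
  have h1 : X * derivative (X ^ n : (ZMod p)[X]) = (n : (ZMod p)[X]) * X ^ n := by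
    cases n with
    | zero => simp
    | succ n => rw [derivative_X_pow]; simp only [Nat.add_sub_cancel, map_natCast]; ring
  have h2 : (1 - X) * derivative ((1 - X) ^ m : (ZMod p)[X]) = - (m : (ZMod p)[X]) * (1 - X) ^ m := by
    cases m with
    | zero => simp
    | succ n =>
      rw [derivative_pow]
      simp only [Nat.add_sub_cancel, map_natCast, derivative_sub, derivative_one, derivative_X]
      ring
  rw [theta_apply, thetaT_apply, derivative_mul, derivative_mul]
  linear_combination (1 - X) * f * (1 - X) ^ m * h1 + X * f * X ^ n * h2

lemma theta_twist_iter {p : ℕ} (n m j : ℕ) : ∀ (f : (ZMod p)[X]),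
    (theta p)^[j] (f * (X ^ n * (1 - X) ^ m)) = ((thetaT p n m)^[j] f) * (X ^ n * (1 - X) ^ m) := by
  induction j with
  | zero => intro f; rfl
  | succ j ih => intro f; rw [Function.iterate_succ_apply, Function.iterate_succ_apply, theta_twist, ih]

lemma thetaT_natDegree {p : ℕ} [Fact p.Prime] (n m : ℕ) (f : (ZMod p)[X]) (d : ℕ) (hd : f.natDegree ≤ d) :
    (thetaT p n m f).natDegree ≤ d + 1 := by
  rw [thetaT_apply]
  have hX : (1 - X : (ZMod p)[X]).natDegree ≤ 1 := by compute_degree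
  by_cases hf : f.natDegree = 0
  · have h0 : derivative f = 0 := derivative_of_natDegree_zero hf
    rw [h0, mul_zero, zero_add]
    refine natDegree_mul_le.trans ?_
    have : ((n : (ZMod p)[X]) * (1 - X) - (m : (ZMod p)[X]) * X).natDegree ≤ 1 := by compute_degree
    omega
  · refine natDegree_add_le_of_degree_le ?_ ?_
    · refine natDegree_mul_le.trans ?_
      have h1 : (X * (1 - X) : (ZMod p)[X]).natDegree ≤ 2 := by compute_degree
      have h2 := natDegree_derivative_lt hf
      omega
    · refine natDegree_mul_le.trans ?_
      have : ((n : (ZMod p)[X]) * (1 - X) - (m : (ZMod p)[X]) * X).natDegree ≤ 1 := by compute_degree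
      omega

lemma thetaT_iter_natDegree {p : ℕ} [Fact p.Prime] (n m j : ℕ) : ∀ (f : (ZMod p)[X]) (d : ℕ),
    f.natDegree ≤ d → ((thetaT p n m)^[j] f).natDegree ≤ d + j := by
  induction j with
  | zero => intro f d h; simpa using h
  | succ j ih =>
    intro f d h
    rw [Function.iterate_succ_apply]
    have := ih _ _ (thetaT_natDegree n m f d h)
    omega

end Stepanov

section Stepanov
open Polynomial

/-- The auxiliary polynomial. -/
noncomputable def auxPoly (p t A B : ℕ) (l : Fin A × Fin B × Fin B → ZMod p) : (ZMod p)[X] :=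
  ∑ i, C (l i) * (X ^ (i.1 : ℕ) * (X ^ (t * (i.2.1 : ℕ)) * (1 - X) ^ (t * (i.2.2 : ℕ))))

lemma auxPoly_ne_zero {p : ℕ} [Fact p.Prime] {t A B : ℕ} (hA : 0 < A) (hB : 0 < B) (hAB : A * B ≤ t)
    (htB : t * B ≤ p) (l : Fin A × Fin B × Fin B → ZMod p) (hl : l ≠ 0) : auxPoly p t A B l ≠ 0 := by
  classical
  intro h0
  have hAt : A ≤ t := le_trans (Nat.le_mul_of_pos_right A hB) hAB
  have ht : 0 < t := by omega
  -- coefficient polynomials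
  set P : Fin B → (ZMod p)[X] := fun c =>
    ∑ ab : Fin A × Fin B, C (l (ab.1, ab.2, c)) * X ^ ((ab.1 : ℕ) + t * (ab.2 : ℕ)) with hP
  have hsum : ∑ c : Fin B, P c * (1 - X) ^ (t * (c : ℕ)) = 0 := by
    rw [← h0, auxPoly]
    simp only [hP, Finset.sum_mul, Fintype.sum_prod_type]
    rw [Finset.sum_comm]
    refine Finset.sum_congr rfl fun a _ => ?_
    rw [Finset.sum_comm]
    refine Finset.sum_congr rfl fun b _ => ?_
    refine Finset.sum_congr rfl fun c _ => ?_
    rw [pow_add]; ring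
  have hinj : ∀ ab ab' : Fin A × Fin B, (ab.1 : ℕ) + t * (ab.2 : ℕ) = (ab'.1 : ℕ) + t * (ab'.2 : ℕ) → ab = ab' := by
    rintro ⟨a, b⟩ ⟨a', b'⟩ h
    simp only at h
    have e1 : ((a : ℕ) + t * b) % t = a := by
      rw [Nat.add_mul_mod_self_left, Nat.mod_eq_of_lt (by omega)]
    have e2 : ((a' : ℕ) + t * b') % t = a' := by
      rw [Nat.add_mul_mod_self_left, Nat.mod_eq_of_lt (by omega)]
    have e3 : (a : ℕ) = a' := by rw [← e1, ← e2, h]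
    have e4 : (b : ℕ) = b' := by
      have : t * (b : ℕ) = t * b' := by omega
      exact Nat.eq_of_mul_eq_mul_left ht this
    ext <;> assumption
  have hcoeff : ∀ c (ab : Fin A × Fin B), (P c).coeff ((ab.1 : ℕ) + t * (ab.2 : ℕ)) = l (ab.1, ab.2, c) := by
    intro c ab
    simp only [hP, finsetSum_coeff, coeff_C_mul, coeff_X_pow]
    rw [Finset.sum_eq_single ab]
    · simp
    · intro b _ hb
      rw [if_neg, mul_zero]
      intro h; exact hb (hinj _ _ h.symm)
    · simp
  have hsupp : ∀ c, (P c).support.card ≤ A * B := by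
    intro c
    have : (P c).support ⊆ Finset.univ.image (fun ab : Fin A × Fin B => (ab.1 : ℕ) + t * (ab.2 : ℕ)) := by
      intro e he
      rw [mem_support_iff] at he
      by_contra hne
      apply he
      simp only [hP, finsetSum_coeff, coeff_C_mul, coeff_X_pow]
      refine Finset.sum_eq_zero fun ab _ => ?_
      rw [if_neg, mul_zero]
      rintro rfl
      exact hne (Finset.mem_image_of_mem _ (Finset.mem_univ _))
    refine (Finset.card_le_card this).trans (Finset.card_image_le.trans ?_)
    simp
  have hdeg : ∀ c, (P c).natDegree < p := by
    intro c
    have hle : (P c).natDegree ≤ A - 1 + t * (B - 1) := by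
      refine natDegree_sum_le_of_forall_le _ _ fun ab _ => ?_
      refine (natDegree_C_mul_X_pow_le _ _).trans ?_
      have h1 : (ab.1 : ℕ) ≤ A - 1 := by omega
      have h2 : (ab.2 : ℕ) ≤ B - 1 := by omega
      exact Nat.add_le_add h1 (Nat.mul_le_mul_left t h2)
    have : t * (B - 1) + t = t * B := by
      obtain ⟨b, rfl⟩ := Nat.exists_eq_succ_of_ne_zero hB.ne'
      simp; ring
    omega
  -- minimal nonzero c
  have hex : ∃ n : ℕ, ∃ c : Fin B, (c : ℕ) = n ∧ P c ≠ 0 := by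
    obtain ⟨i, hi⟩ := Function.ne_iff.mp hl
    refine ⟨_, i.2.2, rfl, fun h => hi ?_⟩
    have := hcoeff i.2.2 (i.1, i.2.1)
    rw [h] at this
    simpa using this.symm
  obtain ⟨c0, hc0, hPc0⟩ := Nat.find_spec hex
  have hmin : ∀ c : Fin B, (c : ℕ) < c0 → P c = 0 := by
    intro c hc
    by_contra hne
    exact Nat.find_min hex (hc0 ▸ hc) ⟨c, rfl, hne⟩
  have hdvd : (1 - X : (ZMod p)[X]) ^ (t * ((c0 : ℕ) + 1)) ∣ P c0 * (1 - X) ^ (t * (c0 : ℕ)) := by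
    rw [← Finset.add_sum_erase _ _ (Finset.mem_univ c0)] at hsum
    rw [eq_neg_of_add_eq_zero_left hsum, dvd_neg]
    refine Finset.dvd_sum fun c hc => ?_
    have hne := Finset.ne_of_mem_erase hc
    rcases lt_or_gt_of_ne (fun h : (c : ℕ) = c0 => hne (Fin.ext h)) with h | h
    · rw [hmin c h, zero_mul]; exact dvd_zero _
    · exact Dvd.dvd.mul_left (pow_dvd_pow _ (Nat.mul_le_mul_left t h)) _
  have hX1 : (1 - X : (ZMod p)[X]) ≠ 0 := by
    intro h
    have := congrArg (fun q => q.eval 0) h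
    simp at this
  have hdvd2 : (1 - X : (ZMod p)[X]) ^ t ∣ P c0 := by
    rw [Nat.mul_add, mul_one, pow_add, mul_comm (P c0)] at hdvd
    exact (mul_dvd_mul_iff_left (pow_ne_zero _ hX1)).mp hdvd
  have hdvd3 : (X - C 1 : (ZMod p)[X]) ^ (A * B) ∣ P c0 := by
    have h1 : (X - C 1 : (ZMod p)[X]) ∣ (1 - X) := ⟨-1, by simp⟩
    exact ((pow_dvd_pow _ hAB).trans (pow_dvd_pow_of_dvd h1 t)).trans hdvd2
  exact sparse_not_dvd (A * B) (P c0) hPc0 (hdeg c0) (hsupp c0) hdvd3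

lemma auxPoly_natDegree {p : ℕ} [Fact p.Prime] {t A B : ℕ} (hA : 0 < A) (hB : 0 < B) (hAt : A ≤ t)
    (l : Fin A × Fin B × Fin B → ZMod p) : (auxPoly p t A B l).natDegree ≤ 2 * t * B := by
  refine natDegree_sum_le_of_forall_le _ _ fun i _ => ?_
  refine (natDegree_C_mul_le _ _).trans (natDegree_mul_le.trans ?_)
  have h1 : (X ^ (i.1 : ℕ) : (ZMod p)[X]).natDegree ≤ t := by
    rw [natDegree_X_pow]; omega
  have h2 : (X ^ (t * (i.2.1 : ℕ)) * (1 - X) ^ (t * (i.2.2 : ℕ)) : (ZMod p)[X]).natDegree ≤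
      t * (i.2.1 : ℕ) + t * (i.2.2 : ℕ) := by
    refine natDegree_mul_le.trans ?_
    have hX : (1 - X : (ZMod p)[X]).natDegree ≤ 1 := by compute_degree
    have := natDegree_pow_le_of_le (t * (i.2.2 : ℕ)) hX
    rw [natDegree_X_pow]
    omega
  have h3 : (i.2.1 : ℕ) + 1 ≤ B := i.2.1.2
  have h4 : (i.2.2 : ℕ) + 1 ≤ B := i.2.2.2
  have h5 := Nat.mul_le_mul_left t h3
  have h6 := Nat.mul_le_mul_left t h4
  have : 2 * t * B = t * B + t * B := by ring
  rw [this]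
  simp only [Nat.mul_add, mul_one] at h5 h6
  omega

/-- existence of coefficients -/
lemma exists_coeffs {p : ℕ} [Fact p.Prime] {t A B : ℕ} (hA : 0 < A) (I : Finset (ZMod p × ZMod p))
    (hcount : 2 * I.card * A < B ^ 2) :
    ∃ l : Fin A × Fin B × Fin B → ZMod p, l ≠ 0 ∧ ∀ ab ∈ I, ∀ m < A,
      ∑ i, C (l i * ab.1 ^ (i.2.1 : ℕ) * ab.2 ^ (i.2.2 : ℕ)) *
        ((thetaT p (t * (i.2.1 : ℕ)) (t * (i.2.2 : ℕ)))^[m] (X ^ (i.1 : ℕ))) = 0 := by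
  classical
  let f : (Fin A × Fin B × Fin B → ZMod p) →ₗ[ZMod p] (I × Fin A × Fin (2 * A) → ZMod p) :=
    { toFun := fun l z => ∑ i, l i * (z.1.1.1 ^ (i.2.1 : ℕ) * z.1.1.2 ^ (i.2.2 : ℕ) *
        ((thetaT p (t * (i.2.1 : ℕ)) (t * (i.2.2 : ℕ)))^[(z.2.1 : ℕ)] (X ^ (i.1 : ℕ))).coeff (z.2.2 : ℕ))
      map_add' := by
        intro l l'
        ext z
        simp only [Pi.add_apply, add_mul, Finset.sum_add_distrib]
      map_smul' := by
        intro r l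
        ext z
        simp only [Pi.smul_apply, smul_eq_mul, RingHom.id_apply, Finset.mul_sum, mul_assoc] }
  have hker : LinearMap.ker f ≠ ⊥ := by
    apply LinearMap.ker_ne_bot_of_finrank_lt
    simp only [Module.finrank_fintype_fun_eq_card, Fintype.card_prod, Fintype.card_fin, Fintype.card_coe]
    calc I.card * (A * (2 * A)) = A * (2 * I.card * A) := by ring
      _ < A * B ^ 2 := Nat.mul_lt_mul_of_pos_left hcount hA
      _ = A * (B * B) := by ring
  obtain ⟨l, hl, hl0⟩ := (Submodule.ne_bot_iff _).mp hker
  refine ⟨l, hl0, ?_⟩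
  intro ab hab m hm
  ext j
  rw [finsetSum_coeff, coeff_zero]
  by_cases hj : j < 2 * A
  · have := congrFun (LinearMap.mem_ker.mp hl) (⟨ab, hab⟩, ⟨m, hm⟩, ⟨j, hj⟩)
    rw [Pi.zero_apply] at this
    rw [← this]
    refine Finset.sum_congr rfl fun i _ => ?_
    rw [coeff_C_mul]
    ring
  · refine Finset.sum_eq_zero fun i _ => ?_
    rw [coeff_C_mul, coeff_eq_zero_of_natDegree_lt, mul_zero]
    have := thetaT_iter_natDegree (p := p) (t * (i.2.1 : ℕ)) (t * (i.2.2 : ℕ)) m (X ^ (i.1 : ℕ)) i.1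
      (by rw [natDegree_X_pow])
    have := i.1.2
    omega

lemma stepanov_B {p : ℕ} [Fact p.Prime] {t B : ℕ} (I : Finset (ZMod p × ZMod p))
    (Z : Finset (ZMod p)) (hZ : ∀ x ∈ Z, x ≠ 0 ∧ x ≠ 1 ∧ (x ^ t, (1 - x) ^ t) ∈ I)
    (hB0 : 0 < B) (hB : 2 * I.card * t < B ^ 3) (hBt : B ≤ t) (htB : t * B ≤ p) :
    Z.card ≤ 4 * B ^ 2 := by
  classical
  set A := t / B with hAdef
  have hA : 0 < A := Nat.div_pos hBt hB0
  have hAB : A * B ≤ t := Nat.div_mul_le_self t B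
  have hAB2 : t < (A + 1) * B := by
    have := Nat.lt_div_mul_add hB0 (a := t)
    rw [add_mul, one_mul]; exact this
  have hAt : A ≤ t := le_trans (Nat.le_mul_of_pos_right A hB0) hAB
  have htp : t ≤ p := le_trans (Nat.le_mul_of_pos_right t hB0) htB
  have hcount : 2 * I.card * A < B ^ 2 := by
    have : 2 * I.card * A * B < B ^ 2 * B := by
      calc 2 * I.card * A * B = 2 * I.card * (A * B) := by ring
        _ ≤ 2 * I.card * t := Nat.mul_le_mul_left _ hAB
        _ < B ^ 3 := hB
        _ = B ^ 2 * B := by ring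
    exact Nat.lt_of_mul_lt_mul_right this
  obtain ⟨l, hl0, hl⟩ := exists_coeffs (t := t) hA I hcount
  set F := auxPoly p t A B l with hF
  have hF0 : F ≠ 0 := auxPoly_ne_zero hA hB0 hAB htB l hl0
  have hmult : ∀ x ∈ Z, A ≤ F.rootMultiplicity x := by
    intro x hx
    obtain ⟨hx0, hx1, hxI⟩ := hZ x hx
    refine le_rootMult x hx0 hx1 A (hAt.trans htp) F hF0 ?_
    intro m hm
    have key := congrArg (fun q => q.eval x) (hl _ hxI m hm)
    simp only [eval_finsetSum, eval_zero, eval_mul, eval_C] at key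
    have hlin : (theta p)^[m] F = ∑ i, C (l i) * (((thetaT p (t * (i.2.1 : ℕ)) (t * (i.2.2 : ℕ)))^[m] (X ^ (i.1 : ℕ))) *
        (X ^ (t * (i.2.1 : ℕ)) * (1 - X) ^ (t * (i.2.2 : ℕ)))) := by
      rw [hF, auxPoly, ← Module.End.pow_apply, map_sum]
      refine Finset.sum_congr rfl fun i _ => ?_
      rw [← smul_eq_C_mul, map_smul, Module.End.pow_apply, theta_twist_iter, smul_eq_C_mul]
    rw [hlin, eval_finsetSum, ← key]
    refine Finset.sum_congr rfl fun i _ => ?_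
    simp only [eval_mul, eval_C, eval_pow, eval_X, eval_sub, eval_one, pow_mul]
    ring
  have hroots : Z.card * A ≤ 2 * t * B := by
    calc Z.card * A = ∑ x ∈ Z, A := by simp
      _ ≤ ∑ x ∈ Z, F.roots.count x := by
        refine Finset.sum_le_sum fun x hx => ?_
        rw [count_roots]; exact hmult x hx
      _ ≤ ∑ x ∈ (Finset.univ : Finset (ZMod p)), F.roots.count x :=
        Finset.sum_le_sum_of_subset (Finset.subset_univ _)
      _ = F.roots.card := Multiset.sum_count_eq_card (by simp)
      _ ≤ F.natDegree := card_roots' F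
      _ ≤ 2 * t * B := auxPoly_natDegree hA hB0 hAt l
  have : Z.card * A ≤ (4 * B ^ 2) * A := by
    calc Z.card * A ≤ 2 * t * B := hroots
      _ ≤ 2 * ((2 * A) * B) * B := by
        have : t ≤ 2 * A * B := by nlinarith
        exact Nat.mul_le_mul_right _ (Nat.mul_le_mul_left _ this)
      _ = (4 * B ^ 2) * A := by ring
  exact Nat.le_of_mul_le_mul_right this hA

lemma exists_cbrt (n : ℕ) (hn : 0 < n) : ∃ B : ℕ, 0 < B ∧ n < B ^ 3 ∧ B ^ 3 ≤ 8 * n := by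
  have hex : ∃ B : ℕ, n < B ^ 3 := ⟨n + 1, by nlinarith [Nat.zero_le n, sq_nonneg (n : ℤ)]⟩
  classical
  refine ⟨Nat.find hex, ?_, Nat.find_spec hex, ?_⟩
  · by_contra h
    have h0 : Nat.find hex = 0 := by omega
    have := Nat.find_spec hex
    rw [h0] at this; simp at this
  · have hpos : Nat.find hex ≠ 0 := by
      intro h0
      have := Nat.find_spec hex
      rw [h0] at this; simp at this
    obtain ⟨b, hb⟩ := Nat.exists_eq_succ_of_ne_zero hpos
    have h1 : ¬ n < b ^ 3 := Nat.find_min hex (by omega)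
    rw [hb]
    push Not at h1
    have hb1 : b ≠ 0 := by
      rintro rfl
      have := Nat.find_spec hex
      rw [hb] at this
      simp at this
      omega
    calc (b + 1) ^ 3 ≤ (2 * b) ^ 3 := Nat.pow_le_pow_left (by omega) 3
      _ = 8 * b ^ 3 := by ring
      _ ≤ 8 * n := by omega

/-- Stepanov bound: `|Z|^3 ≤ 16384 (kt)^2`. -/
lemma stepanov {p : ℕ} [Fact p.Prime] {t k : ℕ} (I : Finset (ZMod p × ZMod p)) (hk : I.card ≤ k)
    (Z : Finset (ZMod p)) (hZ : ∀ x ∈ Z, x ≠ 0 ∧ x ≠ 1 ∧ (x ^ t, (1 - x) ^ t) ∈ I)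
    (hk0 : 0 < k) (ht0 : 0 < t) (h1 : 16 * k ≤ t ^ 2) (h2 : 16 * k * t ^ 4 ≤ p ^ 3) :
    Z.card ^ 3 ≤ 16384 * (k * t) ^ 2 := by
  obtain ⟨B, hB0, hB1, hB2⟩ := exists_cbrt (2 * k * t) (by positivity)
  have hBt : B ≤ t := by
    by_contra h
    push Not at h
    have := Nat.pow_lt_pow_left h (n := 3) (by norm_num)
    have h3 := Nat.mul_le_mul_right t h1
    nlinarith
  have htB : t * B ≤ p := by
    by_contra h
    push Not at h
    have := Nat.pow_lt_pow_left h (n := 3) (by norm_num)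
    have h3 := Nat.mul_le_mul_left (t ^ 3) hB2
    have h4 : (t * B) ^ 3 = t ^ 3 * B ^ 3 := by ring
    have h5 : t ^ 3 * (8 * (2 * k * t)) = 16 * k * t ^ 4 := by ring
    omega
  have hc := stepanov_B I Z hZ hB0
    (lt_of_le_of_lt (Nat.mul_le_mul_right t (Nat.mul_le_mul_left 2 hk)) hB1) hBt htB
  calc Z.card ^ 3 ≤ (4 * B ^ 2) ^ 3 := Nat.pow_le_pow_left hc 3
    _ = 64 * (B ^ 3) ^ 2 := by ring
    _ ≤ 64 * (8 * (2 * k * t)) ^ 2 := Nat.mul_le_mul_left _ (Nat.pow_le_pow_left hB2 2)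
    _ = 16384 * (k * t) ^ 2 := by ring
end Stepanov

section Combi

/-- number of representations of `s` as a difference of elements of `S` -/
def corr {p : ℕ} (S : Finset (ZMod p)) (s : ZMod p) : ℕ := (S.filter (fun b => b + s ∈ S)).card

/-- concrete data of a multiplicative subgroup -/
structure MulSub {p : ℕ} (R : Finset (ZMod p)) : Prop where
  zero : (0 : ZMod p) ∉ R
  one : (1 : ZMod p) ∈ R
  mul : ∀ a ∈ R, ∀ b ∈ R, a * b ∈ R
  inv : ∀ a ∈ R, a⁻¹ ∈ R
  pow : ∀ a ∈ R, a ^ R.card = 1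

/-- invariance under multiplication by `R` -/
def InvSet {p : ℕ} (R S : Finset (ZMod p)) : Prop := ∀ a ∈ R, ∀ b ∈ S, a * b ∈ S

variable {p : ℕ} [Fact p.Prime] {R : Finset (ZMod p)}

lemma MulSub.ne_zero (hR : MulSub R) {a : ZMod p} (ha : a ∈ R) : a ≠ 0 := by
  rintro rfl; exact hR.zero ha

lemma MulSub.card_pos (hR : MulSub R) : 0 < R.card := Finset.card_pos.mpr ⟨1, hR.one⟩

lemma corr_smul (hR : MulSub R) {S : Finset (ZMod p)} (hS : InvSet R S) {a : ZMod p} (ha : a ∈ R) (s : ZMod p) :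
    corr S s ≤ corr S (a * s) := by
  have ha0 := hR.ne_zero ha
  refine Finset.card_le_card_of_injOn (fun b => a * b) ?_ ?_
  · intro b hb
    simp only [coe_filter, Set.mem_ofPred_eq] at hb ⊢
    refine ⟨hS a ha b hb.1, ?_⟩
    rw [← mul_add]
    exact hS a ha _ hb.2
  · intro x _ y _ h
    exact mul_left_cancel₀ ha0 h

lemma corr_neg (S : Finset (ZMod p)) (s : ZMod p) : corr S (-s) = corr S s := by
  refine Finset.card_bij' (fun b _ => b - s) (fun b _ => b + s) ?_ ?_ ?_ ?_
  · intro b hb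
    simp only [mem_filter] at hb ⊢
    refine ⟨by simpa [sub_eq_add_neg] using hb.2, by simpa using hb.1⟩
  · intro b hb
    simp only [mem_filter] at hb ⊢
    refine ⟨hb.2, by simpa using hb.1⟩
  · intro b _; simp
  · intro b _; simp

lemma corr_le (S : Finset (ZMod p)) (s : ZMod p) : corr S s ≤ S.card := Finset.card_filter_le _ _

lemma corr_zero (S : Finset (ZMod p)) : corr S 0 = S.card := by
  simp [corr]

lemma sum_pairs (S : Finset (ZMod p)) (f : ZMod p → ℝ) :
    ∑ a ∈ S, ∑ b ∈ S, f (a - b) = ∑ s, (corr S s : ℝ) * f s := by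
  classical
  rw [Finset.sum_comm]
  have h1 : ∀ b ∈ S, ∑ a ∈ S, f (a - b) = ∑ s, if b + s ∈ S then f s else 0 := by
    intro b _
    rw [← Finset.sum_filter]
    refine Finset.sum_bij' (fun a _ => a - b) (fun s _ => b + s) ?_ ?_ ?_ ?_ ?_
    · intro a ha; simpa using ha
    · intro s hs; simpa using hs
    · intro a _; simp
    · intro a _; simp
    · intro a _; simp
  rw [Finset.sum_congr rfl h1, Finset.sum_comm]
  refine Finset.sum_congr rfl fun s _ => ?_
  rw [← Finset.sum_filter, Finset.sum_const, nsmul_eq_mul, corr]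

lemma sum_corr (S : Finset (ZMod p)) : ∑ s, corr S s = S.card ^ 2 := by
  have := sum_pairs S (fun _ => 1)
  simp only [sum_const, nsmul_eq_mul, mul_one] at this
  have h : ((∑ s, corr S s : ℕ) : ℝ) = ((S.card ^ 2 : ℕ) : ℝ) := by
    push_cast; rw [← this]; ring
  exact_mod_cast h

lemma image_card_mul_le (hR : MulSub R) {Q : Finset (ZMod p)} (hQ : InvSet R Q) (hQ0 : (0 : ZMod p) ∉ Q)
    {β : Type*} [DecidableEq β] (g : ZMod p → β) (hg : ∀ a ∈ R, ∀ s ∈ Q, g (a * s) = g s) :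
    (Q.image g).card * R.card ≤ Q.card := by
  classical
  rw [Finset.card_eq_sum_card_image g Q, ← smul_eq_mul]
  refine Finset.card_nsmul_le_sum _ _ _ ?_
  intro y hy
  obtain ⟨s, hs, rfl⟩ := Finset.mem_image.mp hy
  have hs0 : s ≠ 0 := by rintro rfl; exact hQ0 hs
  refine Finset.card_le_card_of_injOn (fun a => a * s) ?_ ?_
  · intro a ha
    simp only [coe_filter, Set.mem_ofPred_eq]
    exact ⟨hQ a ha s hs, hg a ha s hs⟩
  · intro x _ y _ h
    exact mul_right_cancel₀ hs0 h

/-- level sets -/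
def lev (R : Finset (ZMod p)) (τ : ℕ) : Finset (ZMod p) :=
  Finset.univ.filter (fun s => s ≠ 0 ∧ τ ≤ corr R s)

lemma MulSub.invSelf (hR : MulSub R) : InvSet R R := fun a ha b hb => hR.mul a ha b hb

lemma lev_inv (hR : MulSub R) (τ : ℕ) : InvSet R (lev R τ) := by
  intro a ha s hs
  simp only [lev, mem_filter, mem_univ, true_and] at hs ⊢
  exact ⟨mul_ne_zero (hR.ne_zero ha) hs.1, hs.2.trans (corr_smul hR hR.invSelf ha s)⟩

lemma lev_card (hR : MulSub R) (ht : 16 ≤ R.card) (hp : 16 * R.card ^ 3 ≤ p ^ 2) (τ : ℕ) (hτ : 1 ≤ τ) :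
    (lev R τ).card * τ ^ 3 ≤ 16384 * R.card ^ 3 := by
  classical
  set t := R.card with htdef
  set P := lev R τ with hP
  set g : ZMod p → ZMod p × ZMod p := fun s => ((s⁻¹) ^ t, ((-1) * s⁻¹) ^ t) with hg
  set I := P.image g with hI
  have hP0 : (0 : ZMod p) ∉ P := by simp [hP, lev]
  have hk : I.card * t ≤ P.card := by
    refine image_card_mul_le hR (lev_inv hR τ) hP0 g ?_
    intro a ha s _
    have h1 : (a⁻¹) ^ t = 1 := hR.pow _ (hR.inv a ha)
    simp only [hg, mul_inv, mul_pow, h1, one_mul]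
  by_cases hk0 : I.card = 0
  · have : P = ∅ := by
      rw [Finset.card_eq_zero, hI, Finset.image_eq_empty] at hk0
      exact hk0
    rw [this]; simp
  have hPt : P.card * τ ≤ t ^ 2 := by
    rw [← sum_corr R]
    calc P.card * τ = ∑ s ∈ P, τ := by simp
      _ ≤ ∑ s ∈ P, corr R s := by
        refine Finset.sum_le_sum fun s hs => ?_
        simp only [hP, lev, mem_filter] at hs
        exact hs.2.2
      _ ≤ _ := Finset.sum_le_sum_of_subset (Finset.subset_univ _)
  have hPp : P.card ≤ p := by
    have := Finset.card_le_univ P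
    rwa [ZMod.card] at this
  have ht0 : 0 < t := by omega
  set Z : Finset (ZMod p) := Finset.univ.filter (fun x => x ≠ 0 ∧ x ≠ 1 ∧ (x ^ t, (1 - x) ^ t) ∈ I) with hZ
  have hst := stepanov (t := t) (k := I.card) I le_rfl Z (by intro x hx; simpa [hZ] using hx)
    (by omega) ht0 (by nlinarith) (by
      calc 16 * I.card * t ^ 4 = (I.card * t) * (16 * t ^ 3) := by ring
        _ ≤ p * p ^ 2 := Nat.mul_le_mul (hk.trans hPp) hp
        _ = p ^ 3 := by ring)
  have hcount : P.card * τ ≤ Z.card * t := by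
    calc P.card * τ = ∑ s ∈ P, τ := by simp
      _ ≤ ∑ s ∈ P, corr R s := by
        refine Finset.sum_le_sum fun s hs => ?_
        simp only [hP, lev, mem_filter] at hs
        exact hs.2.2
      _ = (P.sigma (fun s => R.filter (fun b => b + s ∈ R))).card := by
        rw [Finset.card_sigma]; rfl
      _ ≤ (Z ×ˢ R).card := by
        refine Finset.card_le_card_of_injOn (fun u => ((u.2 + u.1) * u.1⁻¹, u.2 + u.1)) ?_ ?_
        · rintro ⟨s, b⟩ hu
          simp only [coe_sigma, Set.mem_sigma_iff, mem_coe, mem_filter] at hu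
          obtain ⟨hs, hb, hbs⟩ := hu
          have hs0 : s ≠ 0 := by rintro rfl; exact hP0 hs
          have hb0 := hR.ne_zero hb
          have hbs0 := hR.ne_zero hbs
          simp only [coe_product, Set.mem_prod, mem_coe, hZ, mem_filter, mem_univ, true_and]
          refine ⟨⟨mul_ne_zero hbs0 (inv_ne_zero hs0), ?_, ?_⟩, hbs⟩
          · intro h
            rw [mul_inv_eq_one₀ hs0] at h
            exact hb0 (by simpa using h)
          · have h1 : 1 - (b + s) * s⁻¹ = b * ((-1) * s⁻¹) := by field_simp; ring
            rw [h1, mul_pow, mul_pow b, hR.pow _ hb, hR.pow _ hbs, one_mul, one_mul]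
            exact Finset.mem_image_of_mem g hs
        · rintro ⟨s, b⟩ hu ⟨s', b'⟩ hu' h
          simp only [coe_sigma, Set.mem_sigma_iff, mem_coe, mem_filter] at hu hu'
          have hbs0 := hR.ne_zero hu.2.2
          simp only [Prod.mk.injEq] at h
          obtain ⟨h1, h2⟩ := h
          rw [← h2] at h1
          have h3 : s = s' := inv_injective (mul_left_cancel₀ hbs0 h1)
          subst h3
          have h4 : b = b' := add_right_cancel h2
          subst h4
          rfl
      _ = Z.card * t := Finset.card_product _ _
  have hfin : P.card ^ 2 * (P.card * τ ^ 3) ≤ P.card ^ 2 * (16384 * t ^ 3) := by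
    calc P.card ^ 2 * (P.card * τ ^ 3) = (P.card * τ) ^ 3 := by ring
      _ ≤ (Z.card * t) ^ 3 := Nat.pow_le_pow_left hcount 3
      _ = Z.card ^ 3 * t ^ 3 := by ring
      _ ≤ (16384 * (I.card * t) ^ 2) * t ^ 3 := Nat.mul_le_mul_right _ hst
      _ ≤ (16384 * P.card ^ 2) * t ^ 3 :=
        Nat.mul_le_mul_right _ (Nat.mul_le_mul_left _ (Nat.pow_le_pow_left hk 2))
      _ = P.card ^ 2 * (16384 * t ^ 3) := by ring
  have hPpos : 0 < P.card := by
    have : 0 < I.card * t := by positivity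
    omega
  exact Nat.le_of_mul_le_mul_left hfin (by positivity)

/-- pointwise bound -/
lemma corr_cube (hR : MulSub R) (ht : 16 ≤ R.card) (hp : 16 * R.card ^ 3 ≤ p ^ 2) (s : ZMod p) (hs : s ≠ 0) :
    corr R s ^ 3 ≤ 16384 * R.card ^ 2 := by
  classical
  by_cases h0 : corr R s = 0
  · rw [h0]; simp
  have h1 := lev_card hR ht hp (corr R s) (by omega)
  have h2 : R.card ≤ (lev R (corr R s)).card := by
    refine Finset.card_le_card_of_injOn (fun a => a * s) ?_ ?_
    · intro a ha
      exact lev_inv hR _ a ha s (by simp [lev, hs])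
    · intro x _ y _ h
      exact mul_right_cancel₀ hs h
  have h3 : R.card * corr R s ^ 3 ≤ R.card * (16384 * R.card ^ 2) := by
    calc R.card * corr R s ^ 3 ≤ (lev R (corr R s)).card * corr R s ^ 3 := Nat.mul_le_mul_right _ h2
      _ ≤ 16384 * R.card ^ 3 := h1
      _ = _ := by ring
  exact Nat.le_of_mul_le_mul_left h3 hR.card_pos

/-- bound for correlations of an invariant set -/
lemma corr_inv (hR : MulSub R) {S : Finset (ZMod p)} (hS : InvSet R S)
    (h1 : 16 * S.card ^ 2 ≤ R.card ^ 4) (h2 : 16 * S.card ^ 2 * R.card ^ 2 ≤ p ^ 3)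
    (q : ZMod p) (hq : q ≠ 0) :
    ∃ n : ℕ, corr S q ≤ n + 2 ∧ n ^ 3 * R.card ^ 2 ≤ 16384 * S.card ^ 4 := by
  classical
  set t := R.card with htdef
  have ht0 : 0 < t := hR.card_pos
  set S0 := S.erase 0 with hS0
  have hS0i : InvSet R S0 := by
    intro a ha b hb
    rw [hS0, mem_erase] at hb ⊢
    exact ⟨mul_ne_zero (hR.ne_zero ha) hb.1, hS a ha b hb.2⟩
  have hS0z : (0 : ZMod p) ∉ S0 := by simp [hS0]
  set g1 : ZMod p → ZMod p := fun s => (s * q⁻¹) ^ t with hg1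
  set g2 : ZMod p → ZMod p := fun s => (s * (-q⁻¹)) ^ t with hg2
  have hk1 : (S0.image g1).card * t ≤ S0.card := by
    refine image_card_mul_le hR hS0i hS0z g1 ?_
    intro a ha s _
    simp only [hg1, mul_pow, htdef, hR.pow _ ha, one_mul]
  have hk2 : (S0.image g2).card * t ≤ S0.card := by
    refine image_card_mul_le hR hS0i hS0z g2 ?_
    intro a ha s _
    simp only [hg2, mul_pow, htdef, hR.pow _ ha, one_mul]
  have hSS : S0.card ≤ S.card := Finset.card_erase_le
  set I := S0.image g1 ×ˢ S0.image g2 with hI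
  have hIc : I.card * t ^ 2 ≤ S.card ^ 2 := by
    rw [hI, Finset.card_product]
    calc _ = ((S0.image g1).card * t) * ((S0.image g2).card * t) := by ring
      _ ≤ S.card * S.card := Nat.mul_le_mul (hk1.trans hSS) (hk2.trans hSS)
      _ = _ := by ring
  set Z : Finset (ZMod p) := Finset.univ.filter (fun x => x ≠ 0 ∧ x ≠ 1 ∧ (x ^ t, (1 - x) ^ t) ∈ I) with hZ
  refine ⟨Z.card, ?_, ?_⟩
  · -- count
    have hsub : (S.filter (fun b => b + q ∈ S)) ⊆
        ((S.filter (fun b => b + q ∈ S)).filter (fun b => b ≠ 0 ∧ b ≠ -q)) ∪ {0, -q} := by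
      intro b hb
      simp only [mem_union, mem_insert, mem_singleton, mem_filter] at hb ⊢
      tauto
    have hc2 : ((S.filter (fun b => b + q ∈ S)).filter (fun b => b ≠ 0 ∧ b ≠ -q)).card ≤ Z.card := by
      refine Finset.card_le_card_of_injOn (fun b => (b + q) * q⁻¹) ?_ ?_
      · intro b hb
        simp only [coe_filter, mem_filter, Set.mem_ofPred_eq] at hb
        obtain ⟨⟨hb, hbq⟩, hb0, hbq0⟩ := hb
        have hbq1 : b + q ≠ 0 := fun h => hbq0 (eq_neg_of_add_eq_zero_left h)
        simp only [hZ, coe_filter, mem_univ, true_and, Set.mem_ofPred_eq]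
        refine ⟨mul_ne_zero hbq1 (inv_ne_zero hq), ?_, ?_⟩
        · intro h
          rw [mul_inv_eq_one₀ hq] at h
          exact hb0 (by simpa using h)
        · rw [hI, mem_product]
          have h1 : 1 - (b + q) * q⁻¹ = b * (-q⁻¹) := by field_simp; ring
          rw [h1]
          exact ⟨Finset.mem_image_of_mem g1 (by simp [hS0, hbq1, hbq]),
            Finset.mem_image_of_mem g2 (by simp [hS0, hb0, hb])⟩
      · intro x _ y _ h
        exact add_right_cancel (mul_right_cancel₀ (inv_ne_zero hq) h)
    calc corr S q ≤ _ := Finset.card_le_card hsub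
      _ ≤ _ := Finset.card_union_le _ _
      _ ≤ Z.card + 2 := Nat.add_le_add hc2 Finset.card_le_two
  · by_cases hk0 : I.card = 0
    · have hIe : I = ∅ := Finset.card_eq_zero.mp hk0
      have : Z = ∅ := by simp [hZ, hIe]
      rw [this]; simp
    have hst := stepanov (t := t) (k := I.card) I le_rfl Z (by intro x hx; simpa [hZ] using hx)
      (by omega) ht0 (by
        have : 16 * I.card * t ^ 2 ≤ t ^ 2 * t ^ 2 := by
          calc _ = 16 * (I.card * t ^ 2) := by ring
            _ ≤ 16 * S.card ^ 2 := Nat.mul_le_mul_left _ hIc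
            _ ≤ t ^ 4 := h1
            _ = _ := by ring
        exact Nat.le_of_mul_le_mul_right this (by positivity)) (by
        calc 16 * I.card * t ^ 4 = 16 * (I.card * t ^ 2) * t ^ 2 := by ring
          _ ≤ 16 * S.card ^ 2 * t ^ 2 := Nat.mul_le_mul_right _ (Nat.mul_le_mul_left _ hIc)
          _ ≤ p ^ 3 := h2)
    calc Z.card ^ 3 * t ^ 2 ≤ (16384 * (I.card * t) ^ 2) * t ^ 2 := Nat.mul_le_mul_right _ hst
      _ = 16384 * (I.card * t ^ 2) ^ 2 := by ring
      _ ≤ 16384 * (S.card ^ 2) ^ 2 := Nat.mul_le_mul_left _ (Nat.pow_le_pow_left hIc 2)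
      _ = _ := by ring
end Combi

section Combi2

/-- Cauchy-Schwarz along the fibres of a map -/
lemma cs_fiber {X Y : Type*} [DecidableEq X] [DecidableEq Y] (U : Finset X) (V : Finset Y) (φ : X → Y)
    (hφ : ∀ u ∈ U, φ u ∈ V) (w : Y → ℝ) :
    (∑ u ∈ U, w (φ u)) ^ 2 ≤ (((U ×ˢ U).filter (fun z => φ z.1 = φ z.2)).card : ℝ) * ∑ y ∈ V, w y ^ 2 := by
  have h1 : ∑ u ∈ U, w (φ u) = ∑ y ∈ V, ((U.filter (fun u => φ u = y)).card : ℝ) * w y := by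
    rw [← Finset.sum_fiberwise_of_maps_to hφ]
    refine Finset.sum_congr rfl fun y _ => ?_
    rw [Finset.sum_congr rfl (g := fun _ => w y)]
    · rw [Finset.sum_const, nsmul_eq_mul]
    · intro u hu; rw [(Finset.mem_filter.mp hu).2]
  have h2 : (((U ×ˢ U).filter (fun z => φ z.1 = φ z.2)).card : ℝ) =
      ∑ y ∈ V, ((U.filter (fun u => φ u = y)).card : ℝ) ^ 2 := by
    have : ((U ×ˢ U).filter (fun z => φ z.1 = φ z.2)).card =
      ∑ y ∈ V, ((U.filter (fun u => φ u = y)).card) ^ 2 := by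
      rw [Finset.card_eq_sum_card_fiberwise (f := fun z : X × X => φ z.1) (t := V)]
      · refine Finset.sum_congr rfl fun y _ => ?_
        rw [sq, ← Finset.card_product]
        congr 1
        ext ⟨a, b⟩
        simp only [mem_filter, mem_product]
        constructor
        · rintro ⟨⟨⟨ha, hb⟩, hab⟩, hy⟩
          exact ⟨⟨ha, hy⟩, hb, by rw [← hab, hy]⟩
        · rintro ⟨⟨ha, hy⟩, hb, hy'⟩
          exact ⟨⟨⟨ha, hb⟩, by rw [hy, hy']⟩, hy⟩
      · intro z hz
        simp only [coe_filter, mem_product, Set.mem_ofPred_eq] at hz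
        exact hφ _ hz.1.1
    exact_mod_cast this
  rw [h1, h2]
  exact Finset.sum_mul_sq_le_sq_mul_sq _ _ _

variable {p : ℕ} [Fact p.Prime] {R : Finset (ZMod p)}

lemma energy_lower (S : Finset (ZMod p)) (σ : ZMod p) (hσ : σ = 1 ∨ σ = -1)
    (hS : ∀ x ∈ R, ∀ y ∈ R, x + σ * y ∈ S) :
    (R.card : ℝ) ^ 4 ≤ (∑ s, (corr R s : ℝ) ^ 2) * S.card := by
  classical
  have h := cs_fiber (R ×ˢ R) S (fun u => u.1 + σ * u.2)
    (by intro u hu; rw [mem_product] at hu; exact hS _ hu.1 _ hu.2) (fun _ => 1)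
  simp only [sum_const, card_product, nsmul_eq_mul, mul_one, one_pow] at h
  have h2 : (((R ×ˢ R) ×ˢ (R ×ˢ R)).filter
      (fun z => z.1.1 + σ * z.1.2 = z.2.1 + σ * z.2.2)).card ≤ ∑ s, corr R s ^ 2 := by
    have e : ∑ s, corr R s ^ 2 = ((Finset.univ : Finset (ZMod p)).sigma
        (fun s => (R.filter (fun b => b + s ∈ R)) ×ˢ (R.filter (fun b => b + s ∈ R)))).card := by
      rw [Finset.card_sigma]
      refine Finset.sum_congr rfl fun s _ => ?_
      rw [Finset.card_product, sq]; rfl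
    rw [e]
    rcases hσ with rfl | rfl
    · refine Finset.card_le_card_of_injOn (fun z => ⟨z.2.1 - z.1.1, z.1.1, z.2.2⟩) ?_ ?_
      · rintro ⟨⟨x, y⟩, ⟨x', y'⟩⟩ hz
        simp only [coe_filter, mem_product, Set.mem_ofPred_eq, one_mul] at hz
        obtain ⟨⟨⟨hx, hy⟩, hx', hy'⟩, he⟩ := hz
        have e1 : y' + (x' - x) = y := by linear_combination -he
        simp only [coe_sigma, Set.mem_sigma_iff, mem_coe, mem_univ, mem_product, mem_filter, true_and,
          add_sub_cancel, e1]
        exact ⟨⟨hx, hx'⟩, hy', hy⟩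
      · rintro ⟨⟨x, y⟩, ⟨x', y'⟩⟩ hz ⟨⟨u, v⟩, ⟨u', v'⟩⟩ hz2 h
        simp only [coe_filter, mem_product, Set.mem_ofPred_eq, one_mul] at hz hz2
        simp only [Sigma.mk.injEq, heq_eq_eq, Prod.mk.injEq] at h
        obtain ⟨h1, h2, h3⟩ := h
        subst h2; subst h3
        have h4 : x' = u' := by simpa using h1
        subst h4
        have h5 : y = v := by linear_combination hz.2 - hz2.2
        rw [h5]
    · refine Finset.card_le_card_of_injOn (fun z => ⟨z.2.1 - z.1.1, z.1.1, z.1.2⟩) ?_ ?_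
      · rintro ⟨⟨x, y⟩, ⟨x', y'⟩⟩ hz
        simp only [coe_filter, mem_product, Set.mem_ofPred_eq] at hz
        obtain ⟨⟨⟨hx, hy⟩, hx', hy'⟩, he⟩ := hz
        have e1 : y + (x' - x) = y' := by linear_combination -he
        simp only [coe_sigma, Set.mem_sigma_iff, mem_coe, mem_univ, mem_product, mem_filter, true_and,
          add_sub_cancel, e1]
        exact ⟨⟨hx, hx'⟩, hy, hy'⟩
      · rintro ⟨⟨x, y⟩, ⟨x', y'⟩⟩ hz ⟨⟨u, v⟩, ⟨u', v'⟩⟩ hz2 h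
        simp only [coe_filter, mem_product, Set.mem_ofPred_eq] at hz hz2
        simp only [Sigma.mk.injEq, heq_eq_eq, Prod.mk.injEq] at h
        obtain ⟨h1, h2, h3⟩ := h
        subst h2; subst h3
        have h4 : x' = u' := by simpa using h1
        subst h4
        have h5 : y' = v' := by linear_combination hz.2 - hz2.2
        rw [h5]
  have h3 : ((((R ×ˢ R) ×ˢ (R ×ˢ R)).filter
      (fun z => z.1.1 + σ * z.1.2 = z.2.1 + σ * z.2.2)).card : ℝ) ≤ ∑ s, (corr R s : ℝ) ^ 2 := by
    exact_mod_cast h2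
  calc (R.card : ℝ) ^ 4 = (((R.card * R.card : ℕ)) : ℝ) ^ 2 := by push_cast; ring
    _ ≤ _ := h
    _ ≤ _ := mul_le_mul_of_nonneg_right h3 (Nat.cast_nonneg _)

lemma triple_count (σ : ZMod p) (hσ : σ = 1 ∨ σ = -1) :
    (((R ×ˢ (R ×ˢ R)) ×ˢ (R ×ˢ (R ×ˢ R))).filter
      (fun z => ((z.1.1 + σ * z.1.2.1, z.1.1 + σ * z.1.2.2) : ZMod p × ZMod p) =
        (z.2.1 + σ * z.2.2.1, z.2.1 + σ * z.2.2.2))).card ≤ ∑ s, corr R s ^ 3 := by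
  classical
  have e : ∑ s, corr R s ^ 3 = ((Finset.univ : Finset (ZMod p)).sigma
      (fun s => (R.filter (fun b => b + s ∈ R)) ×ˢ ((R.filter (fun b => b + s ∈ R)) ×ˢ
        (R.filter (fun b => b + s ∈ R))))).card := by
    rw [Finset.card_sigma]
    refine Finset.sum_congr rfl fun s _ => ?_
    rw [Finset.card_product, Finset.card_product, pow_succ', sq]; rfl
  rw [e]
  rcases hσ with rfl | rfl
  · refine Finset.card_le_card_of_injOn (fun z => ⟨z.2.1 - z.1.1, z.1.1, z.2.2.1, z.2.2.2⟩) ?_ ?_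
    · rintro ⟨⟨x, y, z⟩, ⟨x', y', z'⟩⟩ hz
      simp only [coe_filter, mem_product, Set.mem_ofPred_eq, one_mul, Prod.mk.injEq] at hz
      obtain ⟨⟨⟨hx, hy, hz⟩, hx', hy', hz'⟩, he, he'⟩ := hz
      have e1 : y' + (x' - x) = y := by linear_combination -he
      have e2 : z' + (x' - x) = z := by linear_combination -he'
      simp only [coe_sigma, Set.mem_sigma_iff, mem_coe, mem_univ, mem_product, mem_filter, true_and,
        add_sub_cancel, e1, e2]
      exact ⟨⟨hx, hx'⟩, ⟨hy', hy⟩, hz', hz⟩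
    · rintro ⟨⟨x, y, z⟩, ⟨x', y', z'⟩⟩ hz ⟨⟨u, v, w⟩, ⟨u', v', w'⟩⟩ hz2 h
      simp only [coe_filter, mem_product, Set.mem_ofPred_eq, one_mul, Prod.mk.injEq] at hz hz2
      simp only [Sigma.mk.injEq, heq_eq_eq, Prod.mk.injEq] at h
      obtain ⟨h1, h2, h3, h3'⟩ := h
      subst h2; subst h3; subst h3'
      have h4 : x' = u' := by simpa using h1
      subst h4
      have h5 : y = v := by linear_combination hz.2.1 - hz2.2.1
      have h6 : z = w := by linear_combination hz.2.2 - hz2.2.2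
      rw [h5, h6]
  · refine Finset.card_le_card_of_injOn (fun z => ⟨z.2.1 - z.1.1, z.1.1, z.1.2.1, z.1.2.2⟩) ?_ ?_
    · rintro ⟨⟨x, y, z⟩, ⟨x', y', z'⟩⟩ hz
      simp only [coe_filter, mem_product, Set.mem_ofPred_eq, Prod.mk.injEq] at hz
      obtain ⟨⟨⟨hx, hy, hz⟩, hx', hy', hz'⟩, he, he'⟩ := hz
      have e1 : y + (x' - x) = y' := by linear_combination -he
      have e2 : z + (x' - x) = z' := by linear_combination -he'
      simp only [coe_sigma, Set.mem_sigma_iff, mem_coe, mem_univ, mem_product, mem_filter, true_and,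
        add_sub_cancel, e1, e2]
      exact ⟨⟨hx, hx'⟩, ⟨hy, hy'⟩, hz, hz'⟩
    · rintro ⟨⟨x, y, z⟩, ⟨x', y', z'⟩⟩ hz ⟨⟨u, v, w⟩, ⟨u', v', w'⟩⟩ hz2 h
      simp only [coe_filter, mem_product, Set.mem_ofPred_eq, Prod.mk.injEq] at hz hz2
      simp only [Sigma.mk.injEq, heq_eq_eq, Prod.mk.injEq] at h
      obtain ⟨h1, h2, h3, h3'⟩ := h
      subst h2; subst h3; subst h3'
      have h4 : x' = u' := by simpa using h1
      subst h4
      have h5 : y' = v' := by linear_combination hz.2.1 - hz2.2.1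
      have h6 : z' = w' := by linear_combination hz.2.2 - hz2.2.2
      rw [h5, h6]

/-- punctured correlation, real valued -/
noncomputable def rr (R : Finset (ZMod p)) (s : ZMod p) : ℝ := if s = 0 then 0 else (corr R s : ℝ)

lemma rr_nonneg (s : ZMod p) : 0 ≤ rr R s := by
  unfold rr; split_ifs <;> positivity

lemma main_cs (S : Finset (ZMod p)) (σ : ZMod p) (hσ : σ = 1 ∨ σ = -1)
    (hS : ∀ x ∈ R, ∀ y ∈ R, x + σ * y ∈ S) :
    ((R.card : ℝ) * ∑ s, rr R s ^ 2) ^ 2 ≤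
      (∑ s, (corr R s : ℝ) ^ 3) * ∑ a ∈ S, ∑ b ∈ S, rr R (a - b) ^ 2 := by
  classical
  have h := cs_fiber (R ×ˢ (R ×ˢ R)) (S ×ˢ S) (fun u => (u.1 + σ * u.2.1, u.1 + σ * u.2.2))
    (by
      intro u hu
      simp only [mem_product] at hu ⊢
      exact ⟨hS _ hu.1 _ hu.2.1, hS _ hu.1 _ hu.2.2⟩) (fun y => rr R (y.1 - y.2))
  have heven : ∀ s, rr R (σ * s) = rr R s := by
    intro s
    rcases hσ with rfl | rfl
    · rw [one_mul]
    · rw [neg_one_mul]; unfold rr; rw [corr_neg]; simp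
  have hl : ∑ u ∈ R ×ˢ (R ×ˢ R), rr R ((u.1 + σ * u.2.1) - (u.1 + σ * u.2.2)) =
      (R.card : ℝ) * ∑ s, rr R s ^ 2 := by
    rw [Finset.sum_product]
    have : ∀ x ∈ R, ∑ y ∈ R ×ˢ R, rr R ((x + σ * y.1) - (x + σ * y.2)) = ∑ s, rr R s ^ 2 := by
      intro x _
      have e1 : ∑ y ∈ R ×ˢ R, rr R ((x + σ * y.1) - (x + σ * y.2)) = ∑ a ∈ R, ∑ b ∈ R, rr R (a - b) := by
        rw [Finset.sum_product]
        refine Finset.sum_congr rfl fun a _ => Finset.sum_congr rfl fun b _ => ?_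
        rw [← heven (a - b)]
        congr 1; ring
      rw [e1, sum_pairs]
      refine Finset.sum_congr rfl fun s _ => ?_
      unfold rr
      split_ifs <;> ring
    rw [Finset.sum_congr rfl this, Finset.sum_const, nsmul_eq_mul]
  rw [hl, Finset.sum_product] at h
  refine h.trans ?_
  refine mul_le_mul_of_nonneg_right ?_ (Finset.sum_nonneg fun a _ => Finset.sum_nonneg fun b _ => sq_nonneg _)
  exact_mod_cast triple_count σ hσ

/-- second moment (large sieve type) estimate -/
lemma variance (hR : MulSub R) {S : Finset (ZMod p)} (hS : InvSet R S) (F : ZMod p → ℝ) :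
    (R.card : ℝ) * (∑ a ∈ S, ∑ b ∈ S, F (a - b) - (S.card : ℝ) ^ 2 * (∑ s, F s) / p) ^ 2 ≤
      (S.card : ℝ) ^ 2 * p * ∑ s, F s ^ 2 := by
  classical
  have hp0 : (p : ℝ) ≠ 0 := by exact_mod_cast (Fact.out : p.Prime).ne_zero
  set μ : ℝ := (∑ s, F s) / p with hμ
  set G : ZMod p → ℝ := fun s => F s - μ with hG
  have hGsum : ∑ s, G s = 0 := by
    simp only [hG, Finset.sum_sub_distrib, Finset.sum_const, Finset.card_univ, ZMod.card, nsmul_eq_mul, hμ]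
    field_simp; ring
  have hGsq : ∑ s, G s ^ 2 ≤ ∑ s, F s ^ 2 := by
    have e : ∑ s, F s ^ 2 = ∑ s, G s ^ 2 + 2 * μ * ∑ s, G s + p * μ ^ 2 := by
      have : (p : ℝ) * μ ^ 2 = ∑ s : ZMod p, μ ^ 2 := by
        simp only [Finset.sum_const, Finset.card_univ, ZMod.card, nsmul_eq_mul]
      rw [this, Finset.mul_sum, ← Finset.sum_add_distrib, ← Finset.sum_add_distrib]
      refine Finset.sum_congr rfl fun s _ => ?_
      simp only [hG]; ring
    rw [e, hGsum]
    have : 0 ≤ (p : ℝ) * μ ^ 2 := by positivity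
    linarith
  set T : ℝ := ∑ a ∈ S, ∑ b ∈ S, G (a - b) with hT
  have hTeq : ∑ a ∈ S, ∑ b ∈ S, F (a - b) - (S.card : ℝ) ^ 2 * (∑ s, F s) / p = T := by
    simp only [hT, hG, Finset.sum_sub_distrib, Finset.sum_const, nsmul_eq_mul]
    rw [hμ]; ring
  rw [hTeq]
  have hrot : ∀ ρ ∈ R, ∑ a ∈ S, ∑ b ∈ S, G (a - ρ * b) = T := by
    intro ρ hρ
    refine Finset.sum_congr rfl fun a _ => ?_
    have hρ0 := hR.ne_zero hρ
    refine Finset.sum_bij' (fun b _ => ρ * b) (fun b _ => ρ⁻¹ * b) ?_ ?_ ?_ ?_ ?_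
    · intro b hb; exact hS _ hρ _ hb
    · intro b hb; exact hS _ (hR.inv _ hρ) _ hb
    · intro b _; field_simp
    · intro b _; field_simp
    · intro b _; rfl
  have htT : (R.card : ℝ) * T = ∑ z ∈ S ×ˢ S, ∑ ρ ∈ R, G (z.1 - ρ * z.2) := by
    rw [Finset.sum_comm]
    have : ∀ ρ ∈ R, ∑ z ∈ S ×ˢ S, G (z.1 - ρ * z.2) = T := by
      intro ρ hρ
      rw [Finset.sum_product]; exact hrot ρ hρ
    rw [Finset.sum_congr rfl this, Finset.sum_const, nsmul_eq_mul]
  have hcs : ((R.card : ℝ) * T) ^ 2 ≤ (S.card : ℝ) ^ 2 * ∑ z ∈ S ×ˢ S, (∑ ρ ∈ R, G (z.1 - ρ * z.2)) ^ 2 := by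
    rw [htT]
    have := sq_sum_le_card_mul_sum_sq (s := S ×ˢ S) (f := fun z => ∑ ρ ∈ R, G (z.1 - ρ * z.2))
    rw [Finset.card_product] at this
    refine this.trans (le_of_eq ?_)
    push_cast; ring
  have hfull : ∑ z ∈ S ×ˢ S, (∑ ρ ∈ R, G (z.1 - ρ * z.2)) ^ 2 ≤ (R.card : ℝ) * p * ∑ s, G s ^ 2 := by
    calc ∑ z ∈ S ×ˢ S, (∑ ρ ∈ R, G (z.1 - ρ * z.2)) ^ 2
        ≤ ∑ z : ZMod p × ZMod p, (∑ ρ ∈ R, G (z.1 - ρ * z.2)) ^ 2 :=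
          Finset.sum_le_sum_of_subset_of_nonneg (Finset.subset_univ _) (fun _ _ _ => sq_nonneg _)
      _ = ∑ ρ ∈ R, ∑ ρ' ∈ R, ∑ b : ZMod p, ∑ a : ZMod p, G (a - ρ * b) * G (a - ρ' * b) := by
          rw [Fintype.sum_prod_type]
          simp only [sq, Finset.sum_mul_sum]
          rw [Finset.sum_comm]
          have : ∀ b : ZMod p, ∑ a : ZMod p, ∑ ρ ∈ R, ∑ ρ' ∈ R, G (a - ρ * b) * G (a - ρ' * b) =
              ∑ ρ ∈ R, ∑ ρ' ∈ R, ∑ a : ZMod p, G (a - ρ * b) * G (a - ρ' * b) := by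
            intro b
            rw [Finset.sum_comm]
            exact Finset.sum_congr rfl fun ρ _ => Finset.sum_comm
          rw [Finset.sum_congr rfl fun b _ => this b, Finset.sum_comm]
          exact Finset.sum_congr rfl fun ρ _ => Finset.sum_comm
      _ = ∑ ρ ∈ R, (p : ℝ) * ∑ s, G s ^ 2 := by
          refine Finset.sum_congr rfl fun ρ hρ => ?_
          have hshift : ∀ ρ' b, ∑ a : ZMod p, G (a - ρ * b) * G (a - ρ' * b) =
              ∑ u : ZMod p, G u * G (u + (ρ - ρ') * b) := by
            intro ρ' b
            refine Fintype.sum_equiv (Equiv.subRight (ρ * b)) _ _ fun a => ?_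
            simp only [Equiv.subRight_apply]
            congr 2; ring
          rw [Finset.sum_eq_single_of_mem ρ hρ]
          · rw [Finset.sum_congr rfl fun b _ => hshift ρ b]
            simp only [sub_self, zero_mul, add_zero, Finset.sum_const, Finset.card_univ, ZMod.card,
              nsmul_eq_mul, sq]
          · intro ρ' _ hne
            rw [Finset.sum_congr rfl fun b _ => hshift ρ' b, Finset.sum_comm]
            refine Finset.sum_eq_zero fun u _ => ?_
            rw [← Finset.mul_sum]
            have hd : ρ - ρ' ≠ 0 := sub_ne_zero.mpr (Ne.symm hne)
            have : ∑ b : ZMod p, G (u + (ρ - ρ') * b) = ∑ s, G s := by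
              refine Fintype.sum_equiv ((Equiv.mulLeft₀ (ρ - ρ') hd).trans (Equiv.addLeft u)) _ _ fun b => ?_
              simp
            rw [this, hGsum, mul_zero]
      _ = (R.card : ℝ) * p * ∑ s, G s ^ 2 := by
          rw [Finset.sum_const, nsmul_eq_mul]; ring
  have ht0 : (0 : ℝ) < R.card := by exact_mod_cast hR.card_pos
  have hfin : (R.card : ℝ) * ((R.card : ℝ) * T ^ 2) ≤ (R.card : ℝ) * ((S.card : ℝ) ^ 2 * p * ∑ s, F s ^ 2) := by
    calc (R.card : ℝ) * ((R.card : ℝ) * T ^ 2) = ((R.card : ℝ) * T) ^ 2 := by ring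
      _ ≤ (S.card : ℝ) ^ 2 * ((R.card : ℝ) * p * ∑ s, F s ^ 2) := by
        refine hcs.trans (mul_le_mul_of_nonneg_left (hfull.trans ?_) (by positivity))
        exact mul_le_mul_of_nonneg_left hGsq (by positivity)
      _ = _ := by ring
  exact le_of_mul_le_mul_left hfin ht0

lemma cube_le_layer (n : ℕ) : n ^ 3 ≤ ∑ τ ∈ Finset.Icc 1 n, 3 * τ ^ 2 := by
  induction n with
  | zero => simp
  | succ n ih =>
    rw [Finset.sum_Icc_succ_top (by omega)]
    have : n ^ 3 + 3 * (n + 1) ^ 2 = (n + 1) ^ 3 + (3 * n + 2) := by ring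
    omega

lemma E3_bound (hR : MulSub R) (ht : 16 ≤ R.card) (hp : 16 * R.card ^ 3 ≤ p ^ 2) :
    ∑ s, rr R s ^ 3 ≤ 49152 * (R.card : ℝ) ^ 3 * (1 + Real.log R.card) := by
  classical
  set t := R.card with htdef
  have h1 : ∑ s, rr R s ^ 3 ≤ ∑ τ ∈ Finset.Icc 1 t, 3 * (τ : ℝ) ^ 2 * (lev R τ).card := by
    have h2 : ∀ s, rr R s ^ 3 ≤ ∑ τ ∈ Finset.Icc 1 t, if s ∈ lev R τ then 3 * (τ : ℝ) ^ 2 else 0 := by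
      intro s
      unfold rr
      split_ifs with h0
      · rw [zero_pow (by norm_num)]
        exact Finset.sum_nonneg fun τ _ => by split_ifs <;> positivity
      · rw [← Finset.sum_filter]
        have e : (Finset.Icc 1 t).filter (fun τ => s ∈ lev R τ) = Finset.Icc 1 (corr R s) := by
          ext τ
          have := corr_le R s
          simp only [mem_filter, mem_Icc, lev, mem_univ, true_and, ne_eq, h0, not_false_eq_true]
          omega
        rw [e]
        exact_mod_cast cube_le_layer (corr R s)
    refine (Finset.sum_le_sum fun s _ => h2 s).trans (le_of_eq ?_)
    rw [Finset.sum_comm]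
    refine Finset.sum_congr rfl fun τ _ => ?_
    rw [← Finset.sum_filter, Finset.sum_const, nsmul_eq_mul, mul_comm]
    congr 3
    ext s; simp
  refine h1.trans ?_
  have h3 : ∀ τ ∈ Finset.Icc 1 t, 3 * (τ : ℝ) ^ 2 * (lev R τ).card ≤ 49152 * (t : ℝ) ^ 3 * (τ : ℝ)⁻¹ := by
    intro τ hτ
    have hτ1 : 1 ≤ τ := (Finset.mem_Icc.mp hτ).1
    have hl : ((lev R τ).card : ℝ) * (τ : ℝ) ^ 3 ≤ 16384 * (t : ℝ) ^ 3 := by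
      exact_mod_cast lev_card hR ht hp τ hτ1
    have hτ0 : (0 : ℝ) < τ := by exact_mod_cast hτ1
    rw [← div_eq_mul_inv, le_div_iff₀ hτ0]
    nlinarith
  refine (Finset.sum_le_sum h3).trans ?_
  rw [← Finset.mul_sum]
  refine mul_le_mul_of_nonneg_left ?_ (by positivity)
  have := harmonic_le_one_add_log t
  rw [harmonic_eq_sum_Icc] at this
  push_cast at this
  exact this

end Combi2

section Final
variable {p : ℕ} [Fact p.Prime] {R : Finset (ZMod p)}

lemma sum_corr_pow (k : ℕ) (hk : k ≠ 0) :
    ∑ s, (corr R s : ℝ) ^ k = (R.card : ℝ) ^ k + ∑ s, rr R s ^ k := by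
  classical
  rw [← Finset.add_sum_erase Finset.univ (fun s => (corr R s : ℝ) ^ k) (Finset.mem_univ (0 : ZMod p)),
    ← Finset.add_sum_erase Finset.univ (fun s => rr R s ^ k) (Finset.mem_univ (0 : ZMod p)), corr_zero]
  have h0 : rr R 0 = 0 := by simp [rr]
  rw [h0, zero_pow hk, zero_add]
  congr 1
  refine Finset.sum_congr rfl fun s hs => ?_
  rw [rr, if_neg (Finset.ne_of_mem_erase hs)]

lemma E3_tot (hR : MulSub R) (ht : 16 ≤ R.card) (hp : 16 * R.card ^ 3 ≤ p ^ 2) :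
    ∑ s, (corr R s : ℝ) ^ 3 ≤ 10 ^ 5 * (R.card : ℝ) ^ 3 * Real.logb 2 R.card ∧
    ∑ s, rr R s ^ 3 ≤ 10 ^ 5 * (R.card : ℝ) ^ 3 * Real.logb 2 R.card ∧ 1 ≤ Real.logb 2 R.card := by
  have hE := E3_bound hR ht hp
  have ht' : (16 : ℝ) ≤ R.card := by exact_mod_cast ht
  set t : ℝ := (R.card : ℝ) with htd
  have hL1 : 1 ≤ Real.logb 2 t := by
    rw [Real.le_logb_iff_rpow_le (by norm_num) (by linarith)]
    norm_num; linarith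
  have hlog0 : 0 ≤ Real.log t := Real.log_nonneg (by linarith)
  have hlog : Real.log t ≤ Real.logb 2 t := by
    rw [Real.logb, le_div_iff₀ (Real.log_pos (by norm_num))]
    have : Real.log 2 ≤ 1 := by have := Real.log_two_lt_d9; linarith
    nlinarith
  have h3 : 0 ≤ t ^ 3 := by positivity
  have hb : ∑ s, rr R s ^ 3 ≤ 98304 * t ^ 3 * Real.logb 2 t := by
    refine hE.trans ?_
    nlinarith
  have h4 : t ^ 3 ≤ t ^ 3 * Real.logb 2 t := by nlinarith
  refine ⟨?_, ?_, hL1⟩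
  · rw [sum_corr_pow 3 (by norm_num)]
    nlinarith
  · nlinarith

/-- lower bound for the punctured energy -/
lemma E_lower (hR : MulSub R) (S : Finset (ZMod p)) (σ : ZMod p) (hσ : σ = 1 ∨ σ = -1)
    (hS : ∀ x ∈ R, ∀ y ∈ R, x + σ * y ∈ S) (hn : 2 * (S.card : ℝ) ≤ (R.card : ℝ) ^ 2) :
    (R.card : ℝ) ^ 4 ≤ 2 * S.card * ∑ s, rr R s ^ 2 := by
  have h := energy_lower S σ hσ hS
  rw [sum_corr_pow 2 (by norm_num)] at h
  have h2 : 0 ≤ (R.card : ℝ) ^ 2 := by positivity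
  nlinarith

lemma regime_one (hR : MulSub R) (ht : 16 ≤ R.card) (hp : 16 * R.card ^ 3 ≤ p ^ 2)
    (S : Finset (ZMod p)) (hSi : InvSet R S) (σ : ZMod p) (hσ : σ = 1 ∨ σ = -1)
    (hS : ∀ x ∈ R, ∀ y ∈ R, x + σ * y ∈ S) (hRS : R.card ≤ S.card)
    (h1 : 16 * S.card ^ 2 ≤ R.card ^ 4) (h2 : 16 * S.card ^ 2 * R.card ^ 2 ≤ p ^ 3) :
    (R.card : ℝ) ^ 11 ≤ 10 ^ 21 * Real.logb 2 R.card ^ 3 * (S.card : ℝ) ^ 7 := by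
  classical
  obtain ⟨hE3, -, hL1⟩ := E3_tot hR ht hp
  have ht' : (16 : ℝ) ≤ R.card := by exact_mod_cast ht
  have h1' : 16 * (S.card : ℝ) ^ 2 ≤ (R.card : ℝ) ^ 4 := by exact_mod_cast h1
  have hRS' : (R.card : ℝ) ≤ S.card := by exact_mod_cast hRS
  have hn : 2 * (S.card : ℝ) ≤ (R.card : ℝ) ^ 2 := by
    have : (4 * (S.card : ℝ)) ^ 2 ≤ ((R.card : ℝ) ^ 2) ^ 2 := by nlinarith
    have := le_of_abs_le (abs_le_of_sq_le_sq this (by positivity))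
    have : (0 : ℝ) ≤ S.card := by positivity
    linarith
  have hEl := E_lower hR S σ hσ hS hn
  have hcs := main_cs S σ hσ hS
  set t : ℝ := (R.card : ℝ) with htd
  set n : ℝ := (S.card : ℝ) with hnd
  set L := Real.logb 2 t with hL
  set E := ∑ s, rr R s ^ 2 with hE
  -- maximal correlation
  obtain ⟨q0, hq0, hmax⟩ := Finset.exists_max_image ((Finset.univ : Finset (ZMod p)).erase 0) (corr S)
    ⟨1, by simp⟩
  have hq0' : q0 ≠ 0 := Finset.ne_of_mem_erase hq0
  obtain ⟨k, hk1, hk2⟩ := corr_inv hR hSi h1 h2 q0 hq0'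
  set m : ℝ := (k : ℝ) + 2 with hm
  have hm0 : 0 ≤ m := by positivity
  have hk2' : (k : ℝ) ^ 3 * t ^ 2 ≤ 16384 * n ^ 4 := by rw [htd, hnd]; exact_mod_cast hk2
  have hm3 : m ^ 3 * t ^ 2 ≤ 10 ^ 5 * n ^ 4 := by
    have hk0 : (0 : ℝ) ≤ k := by positivity
    have e1 : m ^ 3 ≤ 4 * ((k : ℝ) ^ 3 + 8) := by
      rw [hm]; nlinarith [mul_nonneg (add_nonneg hk0 (by norm_num : (0:ℝ) ≤ 2)) (sq_nonneg ((k : ℝ) - 2))]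
    have e2 : t ^ 2 ≤ n ^ 4 := by
      have a1 : t ^ 2 ≤ n ^ 2 := by nlinarith
      have a2 : 1 ≤ n ^ 2 := by nlinarith
      nlinarith
    have e3 : 0 ≤ t ^ 2 := by positivity
    have e4 : 0 ≤ n ^ 4 := by positivity
    nlinarith
  have hV : ∑ a ∈ S, ∑ b ∈ S, rr R (a - b) ^ 2 ≤ m * E := by
    rw [sum_pairs S (fun s => rr R s ^ 2), hE, Finset.mul_sum]
    refine Finset.sum_le_sum fun s _ => ?_
    by_cases hs : s = 0
    · simp [rr, hs]
    · refine mul_le_mul_of_nonneg_right ?_ (sq_nonneg _)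
      have := (hmax s (by simp [hs])).trans hk1
      rw [hm]; exact_mod_cast this
  have ht0 : 0 < t := by linarith
  have hn0 : 0 < n := by linarith
  have hE0 : 0 < E := by
    have : 0 < t ^ 4 := by positivity
    by_contra hneg
    push Not at hneg
    nlinarith
  have hV0 : 0 ≤ m * E := by positivity
  have hL0 : 0 ≤ L := by linarith
  have s1 : (t * E) ^ 2 ≤ (10 ^ 5 * t ^ 3 * L) * (m * E) :=
    hcs.trans ((mul_le_mul_of_nonneg_left hV (Finset.sum_nonneg fun s _ => by positivity)).trans
      (mul_le_mul_of_nonneg_right hE3 hV0))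
  have s2 : E ≤ 10 ^ 5 * t * L * m := by
    have : (t ^ 2 * E) * E ≤ (t ^ 2 * E) * (10 ^ 5 * t * L * m) := by
      calc (t ^ 2 * E) * E = (t * E) ^ 2 := by ring
        _ ≤ _ := s1
        _ = _ := by ring
    exact le_of_mul_le_mul_left this (by positivity)
  have s3 : t ^ 3 ≤ 2 * 10 ^ 5 * L * n * m := by
    have : t * t ^ 3 ≤ t * (2 * 10 ^ 5 * L * n * m) := by
      calc t * t ^ 3 = t ^ 4 := by ring
        _ ≤ 2 * n * E := hEl
        _ ≤ 2 * n * (10 ^ 5 * t * L * m) := mul_le_mul_of_nonneg_left s2 (by positivity)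
        _ = _ := by ring
    exact le_of_mul_le_mul_left this ht0
  calc t ^ 11 = (t ^ 3) ^ 3 * t ^ 2 := by ring
    _ ≤ (2 * 10 ^ 5 * L * n * m) ^ 3 * t ^ 2 := by gcongr
    _ = 8 * 10 ^ 15 * L ^ 3 * n ^ 3 * (m ^ 3 * t ^ 2) := by ring
    _ ≤ 8 * 10 ^ 15 * L ^ 3 * n ^ 3 * (10 ^ 5 * n ^ 4) := by gcongr
    _ = 8 * 10 ^ 20 * (L ^ 3 * n ^ 7) := by ring
    _ ≤ 10 ^ 21 * (L ^ 3 * n ^ 7) := by gcongr; norm_num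
    _ = _ := by ring

lemma regime_two (hR : MulSub R) (ht : 16 ≤ R.card) (hp : 16 * R.card ^ 3 ≤ p ^ 2)
    (S : Finset (ZMod p)) (hSi : InvSet R S) (σ : ZMod p) (hσ : σ = 1 ∨ σ = -1)
    (hS : ∀ x ∈ R, ∀ y ∈ R, x + σ * y ∈ S) (hRS : R.card ≤ S.card)
    (hn : 2 * (S.card : ℝ) ≤ (R.card : ℝ) ^ 2) :
    (R.card : ℝ) ^ 3 * p ≤ 4 * 10 ^ 5 * Real.logb 2 R.card * (S.card : ℝ) ^ 3 ∨
    (R.card : ℝ) ^ 34 ≤ 10 ^ 55 * Real.logb 2 R.card ^ 9 * (S.card : ℝ) ^ 18 * (p : ℝ) ^ 3 := by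
  classical
  obtain ⟨hE3, hE3', hL1⟩ := E3_tot hR ht hp
  have ht' : (16 : ℝ) ≤ R.card := by exact_mod_cast ht
  have hRS' : (R.card : ℝ) ≤ S.card := by exact_mod_cast hRS
  have hEl := E_lower hR S σ hσ hS hn
  have hcs := main_cs S σ hσ hS
  have hvar := variance hR hSi (fun s => rr R s ^ 2)
  have hcube := corr_cube hR ht hp
  have hp0 : (0 : ℝ) < p := by exact_mod_cast (Fact.out : p.Prime).pos
  have hcube' : ∀ s, rr R s ^ 3 ≤ 16384 * (R.card : ℝ) ^ 2 := by
    intro s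
    unfold rr
    split_ifs with h
    · rw [zero_pow (by norm_num)]; positivity
    · exact_mod_cast hcube s h
  set t : ℝ := (R.card : ℝ) with htd
  set n : ℝ := (S.card : ℝ) with hnd
  set L := Real.logb 2 t with hL
  set E := ∑ s, rr R s ^ 2 with hE
  set V := ∑ a ∈ S, ∑ b ∈ S, rr R (a - b) ^ 2 with hV
  have ht0 : 0 < t := by linarith
  have hn0 : 0 < n := by linarith
  have hL0 : 0 ≤ L := by linarith
  have hE0 : 0 < E := by
    have : 0 < t ^ 4 := by positivity
    by_contra hneg
    push Not at hneg
    nlinarith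
  have hV0 : 0 ≤ V := Finset.sum_nonneg fun a _ => Finset.sum_nonneg fun b _ => sq_nonneg _
  obtain ⟨ρ, hρ0, hρ⟩ : ∃ ρ : ℝ, 0 ≤ ρ ∧ ρ ^ 3 = 16384 * t ^ 2 := by
    refine ⟨(16384 * t ^ 2) ^ ((1 : ℝ) / 3), by positivity, ?_⟩
    rw [← Real.rpow_natCast, ← Real.rpow_mul (by positivity)]
    norm_num
  have hrρ : ∀ s, rr R s ≤ ρ := by
    intro s
    have := hcube' s
    rw [← hρ] at this
    exact le_of_pow_le_pow_left₀ (by norm_num) hρ0 this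
  have s1 : (t * E) ^ 2 ≤ (10 ^ 5 * t ^ 3 * L) * V :=
    hcs.trans (mul_le_mul_of_nonneg_right hE3 hV0)
  have s2 : E ^ 2 ≤ 10 ^ 5 * t * L * V := by
    have : t ^ 2 * E ^ 2 ≤ t ^ 2 * (10 ^ 5 * t * L * V) := by
      calc _ = (t * E) ^ 2 := by ring
        _ ≤ _ := s1
        _ = _ := by ring
    exact le_of_mul_le_mul_left this (by positivity)
  by_cases hc : V ≤ 2 * (n ^ 2 * E / p)
  · left
    have s3 : E * p ≤ 2 * 10 ^ 5 * t * L * n ^ 2 := by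
      have : E * (E * p) ≤ E * (2 * 10 ^ 5 * t * L * n ^ 2) := by
        calc E * (E * p) = E ^ 2 * p := by ring
          _ ≤ (10 ^ 5 * t * L * V) * p := by gcongr
          _ ≤ (10 ^ 5 * t * L * (2 * (n ^ 2 * E / p))) * p := by gcongr
          _ = _ := by field_simp; try ring
      exact le_of_mul_le_mul_left this hE0
    have : t * (t ^ 3 * p) ≤ t * (4 * 10 ^ 5 * L * n ^ 3) := by
      calc t * (t ^ 3 * p) = t ^ 4 * p := by ring
        _ ≤ (2 * n * E) * p := by gcongr
        _ = 2 * n * (E * p) := by ring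
        _ ≤ 2 * n * (2 * 10 ^ 5 * t * L * n ^ 2) := by gcongr
        _ = _ := by ring
    exact le_of_mul_le_mul_left this ht0
  · right
    push Not at hc
    have hS4 : ∑ s, (rr R s ^ 2) ^ 2 ≤ ρ * (10 ^ 5 * t ^ 3 * L) := by
      calc ∑ s, (rr R s ^ 2) ^ 2 ≤ ∑ s, ρ * rr R s ^ 3 := by
            refine Finset.sum_le_sum fun s _ => ?_
            calc (rr R s ^ 2) ^ 2 = rr R s * rr R s ^ 3 := by ring
              _ ≤ _ := mul_le_mul_of_nonneg_right (hrρ s) (pow_nonneg (rr_nonneg s) 3)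
        _ = ρ * ∑ s, rr R s ^ 3 := by rw [Finset.mul_sum]
        _ ≤ _ := mul_le_mul_of_nonneg_left hE3' hρ0
    have s3 : t * V ^ 2 ≤ 4 * (n ^ 2 * p * (ρ * (10 ^ 5 * t ^ 3 * L))) := by
      have a1 : V ≤ 2 * (V - n ^ 2 * E / p) := by linarith
      calc t * V ^ 2 ≤ t * (2 * (V - n ^ 2 * E / p)) ^ 2 := by gcongr
        _ = 4 * (t * (V - n ^ 2 * E / p) ^ 2) := by ring
        _ ≤ 4 * (n ^ 2 * p * ∑ s, (rr R s ^ 2) ^ 2) := by gcongr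
        _ ≤ _ := by gcongr
    have s3' : V ^ 2 ≤ 4 * 10 ^ 5 * n ^ 2 * p * ρ * t ^ 2 * L := by
      have : t * V ^ 2 ≤ t * (4 * 10 ^ 5 * n ^ 2 * p * ρ * t ^ 2 * L) := by
        refine s3.trans (le_of_eq ?_); ring
      exact le_of_mul_le_mul_left this ht0
    have s4 : E ^ 4 ≤ 4 * 10 ^ 15 * t ^ 4 * L ^ 3 * n ^ 2 * p * ρ := by
      calc E ^ 4 = (E ^ 2) ^ 2 := by ring
        _ ≤ (10 ^ 5 * t * L * V) ^ 2 := by gcongr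
        _ = 10 ^ 10 * t ^ 2 * L ^ 2 * V ^ 2 := by ring
        _ ≤ 10 ^ 10 * t ^ 2 * L ^ 2 * (4 * 10 ^ 5 * n ^ 2 * p * ρ * t ^ 2 * L) := by gcongr
        _ = _ := by ring
    have s5 : t ^ 12 ≤ 64 * 10 ^ 15 * L ^ 3 * n ^ 6 * p * ρ := by
      have : t ^ 4 * t ^ 12 ≤ t ^ 4 * (64 * 10 ^ 15 * L ^ 3 * n ^ 6 * p * ρ) := by
        calc t ^ 4 * t ^ 12 = (t ^ 4) ^ 4 := by ring
          _ ≤ (2 * n * E) ^ 4 := by gcongr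
          _ = 16 * n ^ 4 * E ^ 4 := by ring
          _ ≤ 16 * n ^ 4 * (4 * 10 ^ 15 * t ^ 4 * L ^ 3 * n ^ 2 * p * ρ) := by gcongr
          _ = _ := by ring
      exact le_of_mul_le_mul_left this (by positivity)
    have : t ^ 2 * t ^ 34 ≤ t ^ 2 * (10 ^ 55 * L ^ 9 * n ^ 18 * (p : ℝ) ^ 3) := by
      calc t ^ 2 * t ^ 34 = (t ^ 12) ^ 3 := by ring
        _ ≤ (64 * 10 ^ 15 * L ^ 3 * n ^ 6 * p * ρ) ^ 3 := by gcongr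
        _ = (64 * 10 ^ 15) ^ 3 * L ^ 9 * n ^ 18 * p ^ 3 * ρ ^ 3 := by ring
        _ = ((64 * 10 ^ 15) ^ 3 * 16384) * (t ^ 2 * (L ^ 9 * n ^ 18 * p ^ 3)) := by rw [hρ]; ring
        _ ≤ 10 ^ 55 * (t ^ 2 * (L ^ 9 * n ^ 18 * p ^ 3)) := by gcongr; norm_num
        _ = _ := by ring
    exact le_of_mul_le_mul_left this (by positivity)

/-- final numerical combination; `q` plays the role of `p^δ` -/
lemma combine (hR : MulSub R) (hp : 16 * R.card ^ 3 ≤ p ^ 2)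
    (S : Finset (ZMod p)) (hSi : InvSet R S) (σ : ZMod p) (hσ : σ = 1 ∨ σ = -1)
    (hS : ∀ x ∈ R, ∀ y ∈ R, x + σ * y ∈ S) (hRS : R.card ≤ S.card)
    (q : ℝ) (hq : 10 ^ 55 * Real.logb 2 R.card ^ 9 ≤ q) (hq0 : 10 ^ 55 ≤ q) (hqt : q ^ 100 ≤ R.card)
    (hqp : q ^ 100 ≤ p) (hnY : (S.card : ℝ) ^ 2 ≤ (R.card : ℝ) ^ 3 * q ^ 2) :
    (R.card : ℝ) ^ 3 * p ≤ 4 * 10 ^ 5 * Real.logb 2 R.card * (S.card : ℝ) ^ 3 := by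
  have hq1 : 1 ≤ q := le_trans (by norm_num) hq0
  have hqk : ∀ k : ℕ, 1 ≤ k → k ≤ 100 → q ^ k ≤ q ^ 100 := fun k _ h => pow_le_pow_right₀ hq1 h
  have hqpos : 0 < q := by linarith
  have hqsq : 16 * q ^ 2 ≤ q ^ 3 := by
    have : q ^ 3 = q * q ^ 2 := by ring
    rw [this]; gcongr; exact le_trans (by norm_num) hq0
  have htR : (16 : ℝ) ≤ R.card := by
    have := hqk 1 le_rfl (by norm_num)
    rw [pow_one] at this
    exact le_trans (le_trans (by norm_num) hq0) (this.trans hqt)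
  have ht : 16 ≤ R.card := by exact_mod_cast htR
  obtain ⟨-, -, hL1⟩ := E3_tot hR ht hp
  have hp0 : (0 : ℝ) < p := by exact_mod_cast (Fact.out : p.Prime).pos
  have h1R : 16 * (S.card : ℝ) ^ 2 ≤ (R.card : ℝ) ^ 4 := by
    calc 16 * (S.card : ℝ) ^ 2 ≤ 16 * ((R.card : ℝ) ^ 3 * q ^ 2) := by gcongr
      _ = (R.card : ℝ) ^ 3 * (16 * q ^ 2) := by ring
      _ ≤ (R.card : ℝ) ^ 3 * R.card := by
        gcongr; exact hqsq.trans ((hqk 3 (by norm_num) (by norm_num)).trans hqt)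
      _ = _ := by ring
  have hn : 2 * (S.card : ℝ) ≤ (R.card : ℝ) ^ 2 := by
    have : (4 * (S.card : ℝ)) ^ 2 ≤ ((R.card : ℝ) ^ 2) ^ 2 := by nlinarith
    have := le_of_abs_le (abs_le_of_sq_le_sq this (by positivity))
    have : (0 : ℝ) ≤ S.card := by positivity
    linarith
  have h1 : 16 * S.card ^ 2 ≤ R.card ^ 4 := by exact_mod_cast h1R
  have key1 := fun h2 => regime_one hR ht hp S hSi σ hσ hS hRS h1 h2
  have key2 := regime_two hR ht hp S hSi σ hσ hS hRS hn
  set t : ℝ := (R.card : ℝ) with htd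
  set n : ℝ := (S.card : ℝ) with hnd
  set L := Real.logb 2 t with hL
  have ht0 : 0 < t := by linarith
  have hn0 : 0 ≤ n := by positivity
  by_cases hcase : t ^ 2 ≤ p
  · exfalso
    have h2R : 16 * n ^ 2 * t ^ 2 ≤ (p : ℝ) ^ 3 := by
      have a : 16 * n ^ 2 * t ^ 2 ≤ 16 * t ^ 5 * q ^ 2 := by
        calc 16 * n ^ 2 * t ^ 2 ≤ 16 * (t ^ 3 * q ^ 2) * t ^ 2 := by gcongr
          _ = _ := by ring
      refine a.trans (le_of_abs_le (abs_le_of_sq_le_sq ?_ (by positivity)))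
      calc (16 * t ^ 5 * q ^ 2) ^ 2 = (t ^ 2) ^ 5 * (16 * q ^ 2) ^ 2 := by ring
        _ ≤ (p : ℝ) ^ 5 * (q ^ 3) ^ 2 := by gcongr
        _ = (p : ℝ) ^ 5 * q ^ 6 := by ring
        _ ≤ (p : ℝ) ^ 5 * p := by gcongr; exact (hqk 6 (by norm_num) (by norm_num)).trans hqp
        _ = _ := by ring
    rw [htd, hnd] at h2R
    have k := key1 (by exact_mod_cast h2R)
    have hLq : 10 ^ 21 * L ^ 3 ≤ q := by
      refine le_trans ?_ hq
      gcongr <;> norm_num [hL1]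
    have k2 : t ^ 21 * t ≤ t ^ 21 * q ^ 16 := by
      calc t ^ 21 * t = (t ^ 11) ^ 2 := by ring
        _ ≤ (10 ^ 21 * L ^ 3 * n ^ 7) ^ 2 := by gcongr
        _ = (10 ^ 21 * L ^ 3) ^ 2 * (n ^ 2) ^ 7 := by ring
        _ ≤ q ^ 2 * (t ^ 3 * q ^ 2) ^ 7 := by gcongr
        _ = _ := by ring
    have k3 : t ≤ q ^ 16 := le_of_mul_le_mul_left k2 (by positivity)
    have k4 : q ^ 16 < q ^ 100 := pow_lt_pow_right₀ (lt_of_lt_of_le (by norm_num) hq0) (by norm_num)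
    linarith
  · rcases key2 with h | h
    · exact h
    · exfalso
      push Not at hcase
      have k1 : t ^ 27 * t ^ 7 ≤ t ^ 27 * (q ^ 19 * (p : ℝ) ^ 3) := by
        calc t ^ 27 * t ^ 7 = t ^ 34 := by ring
          _ ≤ _ := h
          _ = 10 ^ 55 * L ^ 9 * (n ^ 2) ^ 9 * (p : ℝ) ^ 3 := by ring
          _ ≤ q * (t ^ 3 * q ^ 2) ^ 9 * (p : ℝ) ^ 3 := by gcongr
          _ = _ := by ring
      have k2 : t ^ 7 ≤ q ^ 19 * (p : ℝ) ^ 3 := le_of_mul_le_mul_left k1 (by positivity)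
      have k3 : (p : ℝ) ^ 6 * p ≤ (p : ℝ) ^ 6 * q ^ 38 := by
        calc (p : ℝ) ^ 6 * p = (p : ℝ) ^ 7 := by ring
          _ ≤ (t ^ 2) ^ 7 := by gcongr
          _ = (t ^ 7) ^ 2 := by ring
          _ ≤ (q ^ 19 * (p : ℝ) ^ 3) ^ 2 := by gcongr
          _ = _ := by ring
      have k4 : (p : ℝ) ≤ q ^ 38 := le_of_mul_le_mul_left k3 (by positivity)
      have k5 : q ^ 38 < q ^ 100 := pow_lt_pow_right₀ (lt_of_lt_of_le (by norm_num) hq0) (by norm_num)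
      linarith
end Final

section Wrap

lemma mulSub_of {p : ℕ} [Fact p.Prime] {R : Finset (ZMod p)} (h : IsMulSubgroup p R) : MulSub R := by
  obtain ⟨H, hH⟩ := h
  have hmem : ∀ a, a ∈ R ↔ ∃ u ∈ H, (u : ZMod p) = a := by
    intro a
    rw [← Finset.mem_coe, hH]
    rfl
  have hcard : Nat.card H = R.card := by
    have h1 : (R : Set (ZMod p)).ncard = (H : Set (ZMod p)ˣ).ncard := by
      rw [hH]
      exact Set.ncard_image_of_injective _ Units.val_injective
    rw [Set.ncard_coe_finset] at h1
    rw [h1]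
    rfl
  refine ⟨?_, ?_, ?_, ?_, ?_⟩
  · rw [hmem]
    rintro ⟨u, -, hu⟩
    exact u.ne_zero hu
  · rw [hmem]
    exact ⟨1, H.one_mem, rfl⟩
  · intro a ha b hb
    rw [hmem] at *
    obtain ⟨u, hu, rfl⟩ := ha
    obtain ⟨v, hv, rfl⟩ := hb
    exact ⟨u * v, H.mul_mem hu hv, by simp⟩
  · intro a ha
    rw [hmem] at *
    obtain ⟨u, hu, rfl⟩ := ha
    exact ⟨u⁻¹, H.inv_mem hu, Units.val_inv_eq_inv_val u⟩
  · intro a ha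
    rw [hmem] at ha
    obtain ⟨u, hu, rfl⟩ := ha
    rw [← hcard]
    have h1 : (⟨u, hu⟩ : H) ^ Nat.card H = 1 := pow_card_eq_one'
    have h2 : u ^ Nat.card H = 1 := by
      exact congrArg (fun x : H => (x : (ZMod p)ˣ)) h1
    rw [← Units.val_pow_eq_pow_val, h2, Units.val_one]

lemma exists_threshold (δ : ℝ) (hδ : 0 < δ) :
    ∃ p₀ : ℕ, 2 ≤ p₀ ∧ ∀ p : ℕ, p₀ ≤ p → 10 ^ 55 * Real.logb 2 p ^ 9 ≤ (p : ℝ) ^ δ := by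
  have hl2 : 0 < Real.log 2 := Real.log_pos (by norm_num)
  have h := (isLittleO_log_rpow_rpow_atTop (9 : ℝ) hδ).bound
    (show 0 < Real.log 2 ^ 9 / 10 ^ 55 by positivity)
  have h' := tendsto_natCast_atTop_atTop (R := ℝ) |>.eventually h
  obtain ⟨N, hN⟩ := Filter.eventually_atTop.mp h'
  refine ⟨max N 2, le_max_right _ _, fun p hp => ?_⟩
  have h1 := hN p ((le_max_left _ _).trans hp)
  have hp2 : 2 ≤ p := (le_max_right _ _).trans hp
  have hp2' : (2 : ℝ) ≤ p := by exact_mod_cast hp2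
  have hlog : 0 ≤ Real.log p := Real.log_nonneg (by linarith)
  rw [Real.norm_of_nonneg (by positivity), Real.norm_of_nonneg (by positivity)] at h1
  have h2 : Real.log (p : ℝ) ^ (9 : ℝ) = Real.log (p : ℝ) ^ 9 := by
    exact_mod_cast Real.rpow_natCast (Real.log (p : ℝ)) 9
  rw [h2] at h1
  rw [Real.logb, div_pow, ← mul_div_assoc, div_le_iff₀ (by positivity)]
  have h3 := mul_le_mul_of_nonneg_left h1 (show (0 : ℝ) ≤ 10 ^ 55 by positivity)
  refine h3.trans (le_of_eq ?_)
  field_simp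

lemma one_side {p : ℕ} [Fact p.Prime] {R : Finset (ZMod p)} (ε : ℝ) (hε0 : 0 < ε) (hε1 : ε ≤ 1)
    (hth : 10 ^ 55 * Real.logb 2 p ^ 9 ≤ (p : ℝ) ^ (ε / 100))
    (hR : MulSub R) (S : Finset (ZMod p)) (hSi : InvSet R S) (σ : ZMod p) (hσ : σ = 1 ∨ σ = -1)
    (hS : ∀ x ∈ R, ∀ y ∈ R, x + σ * y ∈ S) (hRS : R.card ≤ S.card)
    (hlow : (p : ℝ) ^ ε ≤ (R.card : ℝ))
    (hup : (R.card : ℝ) ≤ 1 / 4 * (p : ℝ) ^ ((2 : ℝ) / 3)) :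
    1 / 100 * min ((R.card : ℝ) * (p : ℝ) ^ ((1 : ℝ) / 3) *
                    Real.logb 2 (R.card : ℝ) ^ (-(1 : ℝ) / 3))
                ((R.card : ℝ) ^ ((3 : ℝ) / 2) * (p : ℝ) ^ (ε / 100))
              ≤ (S.card : ℝ) := by
  have hp2 : (2 : ℝ) ≤ p := by exact_mod_cast (Fact.out : p.Prime).two_le
  have hp0 : (0 : ℝ) < p := by linarith
  have hp1 : (1 : ℝ) ≤ p := by linarith
  have hlp : 1 ≤ Real.logb 2 p := by
    rw [Real.le_logb_iff_rpow_le (by norm_num) hp0, Real.rpow_one]; exact hp2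
  have ht1 : (1 : ℝ) ≤ R.card := by exact_mod_cast hR.card_pos
  have htp : (R.card : ℝ) ≤ p := by
    have : R.card ≤ p := by simpa [ZMod.card] using Finset.card_le_univ R
    exact_mod_cast this
  have hLt : Real.logb 2 R.card ≤ Real.logb 2 p :=
    Real.logb_le_logb_of_le (by norm_num) (by linarith) htp
  have hLt0 : 0 ≤ Real.logb 2 R.card := Real.logb_nonneg (by norm_num) ht1
  have h16 : 16 * R.card ^ 3 ≤ p ^ 2 := by
    have h1 : (R.card : ℝ) ^ 3 ≤ (1 / 4 * (p : ℝ) ^ ((2 : ℝ) / 3)) ^ 3 := by gcongr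
    have h2 : ((p : ℝ) ^ ((2 : ℝ) / 3)) ^ 3 = (p : ℝ) ^ 2 := by
      rw [← Real.rpow_natCast, ← Real.rpow_mul hp0.le, ← Real.rpow_natCast]
      norm_num
    rw [mul_pow, h2] at h1
    have h3 : 16 * (R.card : ℝ) ^ 3 ≤ (p : ℝ) ^ 2 := by nlinarith [sq_nonneg (p : ℝ)]
    exact_mod_cast h3
  have hq100 : ((p : ℝ) ^ (ε / 100)) ^ 100 = (p : ℝ) ^ ε := by
    rw [← Real.rpow_natCast, ← Real.rpow_mul hp0.le]
    congr 1
    push_cast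
    ring
  have hq1 : 10 ^ 55 * Real.logb 2 R.card ^ 9 ≤ (p : ℝ) ^ (ε / 100) := by
    refine le_trans ?_ hth
    gcongr
  have hq2 : 10 ^ 55 ≤ (p : ℝ) ^ (ε / 100) := by
    refine le_trans ?_ hth
    have := one_le_pow₀ (n := 9) hlp
    linarith
  have hqp : ((p : ℝ) ^ (ε / 100)) ^ 100 ≤ p := by
    rw [hq100]
    calc (p : ℝ) ^ ε ≤ (p : ℝ) ^ (1 : ℝ) := Real.rpow_le_rpow_of_exponent_le hp1 hε1
      _ = p := Real.rpow_one _
  have hcomb := combine hR h16 S hSi σ hσ hS hRS ((p : ℝ) ^ (ε / 100)) hq1 hq2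
    (by rw [hq100]; exact hlow) hqp
  have hL1 : 1 ≤ Real.logb 2 R.card := by
    rw [Real.le_logb_iff_rpow_le (by norm_num) (by linarith), Real.rpow_one]
    have : (p : ℝ) ^ (ε / 100) ≤ ((p : ℝ) ^ (ε / 100)) ^ 100 :=
      le_self_pow₀ (le_trans (by norm_num) hq2) (by norm_num)
    rw [hq100] at this
    exact le_trans (le_trans (by norm_num) hq2) (this.trans hlow)
  set q := (p : ℝ) ^ (ε / 100) with hqd
  set L := Real.logb 2 R.card with hLd
  have hn0 : (0 : ℝ) ≤ S.card := by positivity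
  have hq0 : 0 < q := by positivity
  by_cases hc : (R.card : ℝ) ^ ((3 : ℝ) / 2) * q ≤ S.card
  · have h0 : 0 ≤ (R.card : ℝ) ^ ((3 : ℝ) / 2) * q := by positivity
    have := min_le_right ((R.card : ℝ) * (p : ℝ) ^ ((1 : ℝ) / 3) * L ^ (-(1 : ℝ) / 3))
      ((R.card : ℝ) ^ ((3 : ℝ) / 2) * q)
    linarith
  · push Not at hc
    have hY : (S.card : ℝ) ^ 2 ≤ (R.card : ℝ) ^ 3 * q ^ 2 := by
      have h1 : (S.card : ℝ) ^ 2 ≤ ((R.card : ℝ) ^ ((3 : ℝ) / 2) * q) ^ 2 := by gcongr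
      have h2 : ((R.card : ℝ) ^ ((3 : ℝ) / 2)) ^ 2 = (R.card : ℝ) ^ 3 := by
        rw [← Real.rpow_natCast, ← Real.rpow_mul (by positivity), ← Real.rpow_natCast]
        norm_num
      rwa [mul_pow, h2] at h1
    have key := hcomb hY
    have hX : 1 / 100 * ((R.card : ℝ) * (p : ℝ) ^ ((1 : ℝ) / 3) * L ^ (-(1 : ℝ) / 3)) ≤ S.card := by
      have hL0 : 0 < L := by linarith
      have e1 : ((p : ℝ) ^ ((1 : ℝ) / 3)) ^ 3 = p := by
        rw [← Real.rpow_natCast, ← Real.rpow_mul hp0.le]; norm_num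
      have e2 : (L ^ (-(1 : ℝ) / 3)) ^ 3 = L⁻¹ := by
        rw [← Real.rpow_natCast, ← Real.rpow_mul hL0.le, ← Real.rpow_neg_one]; norm_num
      refine le_of_pow_le_pow_left₀ (n := 3) (by norm_num) hn0 ?_
      rw [mul_pow, mul_pow, mul_pow, e1, e2, ← div_eq_mul_inv, ← mul_div_assoc, div_le_iff₀ hL0]
      have : 0 ≤ L * (S.card : ℝ) ^ 3 := by positivity
      nlinarith
    refine le_trans ?_ hX
    gcongr
    exact min_le_left _ _

end Wrap

theorem sumset_lower_bound_small_subgroups (ε : ℝ) (hε0 : 0 < ε) (hε1 : ε ≤ 1) :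
    ∃ (p₀ : ℕ) (δ c C : ℝ), 0 < p₀ ∧ 0 < δ ∧ 0 < c ∧ 0 < C ∧
      ∀ p : ℕ, p.Prime → p₀ ≤ p →
        ∀ R : Finset (ZMod p), IsMulSubgroup p R →
          (p : ℝ) ^ ε ≤ (R.card : ℝ) →
          (R.card : ℝ) ≤ c * (p : ℝ) ^ ((2 : ℝ) / 3) →
          C * min ((R.card : ℝ) * (p : ℝ) ^ ((1 : ℝ) / 3) *
                    Real.logb 2 (R.card : ℝ) ^ (-(1 : ℝ) / 3))
                ((R.card : ℝ) ^ ((3 : ℝ) / 2) * (p : ℝ) ^ δ)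
              ≤ ((R - R).card : ℝ) ∧
          C * min ((R.card : ℝ) * (p : ℝ) ^ ((1 : ℝ) / 3) *
                    Real.logb 2 (R.card : ℝ) ^ (-(1 : ℝ) / 3))
                ((R.card : ℝ) ^ ((3 : ℝ) / 2) * (p : ℝ) ^ δ)
              ≤ ((R + R).card : ℝ) := by
  obtain ⟨p₀, hp₀, hth⟩ := exists_threshold (ε / 100) (by positivity)
  refine ⟨p₀, ε / 100, 1 / 4, 1 / 100, by omega, by positivity, by norm_num, by norm_num, ?_⟩
  intro p hp hpp R hRs hlow hup
  haveI : Fact p.Prime := ⟨hp⟩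
  have hR := mulSub_of hRs
  have hne : R.Nonempty := ⟨1, hR.one⟩
  constructor
  · refine one_side ε hε0 hε1 (hth p hpp) hR (R - R) ?_ (-1) (Or.inr rfl) ?_
      (Finset.card_le_card_sub_right hne) hlow hup
    · intro a ha b hb
      obtain ⟨x, hx, y, hy, rfl⟩ := Finset.mem_sub.mp hb
      rw [mul_sub]
      exact Finset.sub_mem_sub (hR.mul a ha x hx) (hR.mul a ha y hy)
    · intro x hx y hy
      have : x + -1 * y = x - y := by ring
      rw [this]
      exact Finset.sub_mem_sub hx hy
  · refine one_side ε hε0 hε1 (hth p hpp) hR (R + R) ?_ 1 (Or.inl rfl) ?_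
      (Finset.card_le_card_add_right hne) hlow hup
    · intro a ha b hb
      obtain ⟨x, hx, y, hy, rfl⟩ := Finset.mem_add.mp hb
      rw [mul_add]
      exact Finset.add_mem_add (hR.mul a ha x hx) (hR.mul a ha y hy)
    · intro x hx y hy
      rw [one_mul]
      exact Finset.add_mem_add hx hy
end

section
/- There exist constants c > 0 and C > 0 such that for every prime p and every multiplicative subgroup R ⊆ F_p* with |R| ≤ c·p^{2/3}, the additive energy satisfies E(R) ≤ C·|R|^{5/2}. -/
open Finset Pointwise

/-- The additive energy `E(A,B)`: the number of quadruples `(a₁, a₂, b₁, b₂)`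
with `a₁ + b₁ = a₂ + b₂`. -/
def addE {G : Type*} [AddCommGroup G] [DecidableEq G] (A B : Finset G) : ℕ :=
  (((A ×ˢ A) ×ˢ B ×ˢ B).filter fun q => q.1.1 + q.2.1 = q.1.2 + q.2.2).card

namespace HBK
open Polynomial

variable {p : ℕ} [Fact p.Prime]

lemma sparse (k : ℕ) : ∀ g : (ZMod p)[X], g.support.card ≤ k → g.natDegree < p →
    (X - 1) ^ k ∣ g → g = 0 := by
  induction k with
  | zero =>
    intro g h _ _
    simpa using h
  | succ k ih =>
    intro g hs hd hdiv
    by_contra hg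
    set n := g.natDegree with hn
    have hc : ∀ i : ℕ, (X * derivative g - C (n : ZMod p) * g).coeff i
        = ((i : ZMod p) - n) * g.coeff i := by
      intro i
      rw [coeff_sub, coeff_C_mul]
      cases i with
      | zero => simp
      | succ i => rw [coeff_X_mul, coeff_derivative]; push_cast; ring
    have hsub : (X * derivative g - C (n : ZMod p) * g).support ⊆ g.support.erase n := by
      intro i hi
      rw [mem_support_iff, hc] at hi
      rw [Finset.mem_erase, mem_support_iff]
      refine ⟨?_, right_ne_zero_of_mul hi⟩
      rintro rfl
      simp at hi
    have hnmem : n ∈ g.support := natDegree_mem_support_of_nonzero hg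
    have hG : X * derivative g - C (n : ZMod p) * g = 0 := by
      apply ih
      · have := Finset.card_le_card hsub
        rw [Finset.card_erase_of_mem hnmem] at this
        omega
      · refine lt_of_le_of_lt ?_ hd
        rw [natDegree_le_iff_coeff_eq_zero]
        intro i hi
        rw [hc, coeff_eq_zero_of_natDegree_lt hi, mul_zero]
      · apply dvd_sub
        · apply Dvd.dvd.mul_left
          obtain ⟨q, rfl⟩ := hdiv
          rw [derivative_mul, derivative_pow]
          refine dvd_add ?_ ?_
          · simp only [Nat.add_sub_cancel]
            exact ((dvd_mul_left _ _).mul_right _).mul_right _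
          · exact (pow_dvd_pow _ (Nat.le_succ k)).mul_right _
        · exact ((pow_dvd_pow _ (Nat.le_succ k)).trans hdiv).mul_left _
    have hz : ∀ i : ℕ, i ≠ n → g.coeff i = 0 := by
      intro i hi
      by_cases hin : n < i
      · exact coeff_eq_zero_of_natDegree_lt hin
      have h1 := hc i
      rw [hG, coeff_zero] at h1
      rcases mul_eq_zero.1 h1.symm with h2 | h2
      · exfalso
        rw [sub_eq_zero] at h2
        have h3 := (ZMod.natCast_eq_natCast_iff' i n p).1 h2
        rw [Nat.mod_eq_of_lt (by omega), Nat.mod_eq_of_lt hd] at h3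
        exact hi h3
      · exact h2
    have hm : g = monomial n (g.coeff n) := by
      ext i
      rw [coeff_monomial]
      split_ifs with h
      · rw [h]
      · exact hz i (Ne.symm h)
    have he : g.eval 1 = 0 := by
      obtain ⟨q, hq⟩ := hdiv
      rw [hq]; simp
    rw [hm] at he
    simp at he
    exact hg (leadingCoeff_eq_zero.1 he)

lemma indepX (t : ℕ) : ∀ (B : ℕ) (f : Fin B → (ZMod p)[X]), (∀ b, (f b).degree < t) →
    ∑ b, f b * X ^ (t * (b : ℕ)) = 0 → ∀ b, f b = 0 := by
  intro B
  induction B with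
  | zero => intro f _ _ b; exact b.elim0
  | succ B ih =>
    intro f hf hs
    rw [Fin.sum_univ_succ] at hs
    have h1 : ∑ i : Fin B, f i.succ * X ^ (t * ((i.succ : Fin (B+1)) : ℕ))
        = (∑ i : Fin B, f i.succ * X ^ (t * (i : ℕ))) * X ^ t := by
      rw [Finset.sum_mul]
      refine Finset.sum_congr rfl fun i _ => ?_
      rw [Fin.val_succ, mul_assoc, ← pow_add]; rfl
    rw [h1] at hs
    simp only [Fin.val_zero, mul_zero, pow_zero, mul_one] at hs
    have h0 : f 0 = 0 := by
      by_contra hne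
      have hd : X ^ t ∣ f 0 := by
        rw [eq_neg_of_add_eq_zero_left hs]
        exact (dvd_mul_left _ _).neg_right
      have := degree_le_of_dvd hd hne
      rw [degree_X_pow] at this
      exact absurd (hf 0) (not_lt.2 this)
    rw [h0, zero_add] at hs
    have h2 := (mul_eq_zero.1 hs).resolve_right (pow_ne_zero _ X_ne_zero)
    have h3 := ih (fun i => f i.succ) (fun i => hf _) h2
    intro b
    exact Fin.cases h0 h3 b

lemma indepX1 (t : ℕ) : ∀ (B : ℕ) (f : Fin B → (ZMod p)[X]),
    (∀ b, (f b).support.card ≤ t) → (∀ b, (f b).natDegree < p) →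
    ∑ b, f b * (X - 1) ^ (t * (b : ℕ)) = 0 → ∀ b, f b = 0 := by
  intro B
  induction B with
  | zero => intro f _ _ _ b; exact b.elim0
  | succ B ih =>
    intro f hf hf' hs
    rw [Fin.sum_univ_succ] at hs
    have h1 : ∑ i : Fin B, f i.succ * (X - 1) ^ (t * ((i.succ : Fin (B+1)) : ℕ))
        = (∑ i : Fin B, f i.succ * (X - 1) ^ (t * (i : ℕ))) * (X - 1) ^ t := by
      rw [Finset.sum_mul]
      refine Finset.sum_congr rfl fun i _ => ?_
      rw [Fin.val_succ, mul_assoc, ← pow_add]; rfl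
    rw [h1] at hs
    simp only [Fin.val_zero, mul_zero, pow_zero, mul_one] at hs
    have h0 : f 0 = 0 := by
      apply sparse t _ (hf 0) (hf' 0)
      rw [eq_neg_of_add_eq_zero_left hs]
      exact (dvd_mul_left _ _).neg_right
    rw [h0, zero_add] at hs
    have h2 := (mul_eq_zero.1 hs).resolve_right (pow_ne_zero _ (by
      rw [← C_1]; exact X_sub_C_ne_zero 1))
    have h3 := ih (fun i => f i.succ) (fun i => hf _) (fun i => hf' _) h2
    intro b
    exact Fin.cases h0 h3 b

lemma indep (t A B C : ℕ) (hA : 0 < A) (hB : 0 < B) (hAB : A * B ≤ t) (htB : t * B ≤ p)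
    (f : Fin B → Fin C → (ZMod p)[X])
    (hf : ∀ b c, (f b c).natDegree < A)
    (h : ∑ b, ∑ c, f b c * (X ^ (t * (b : ℕ)) * (X - 1) ^ (t * (c : ℕ))) = 0) :
    ∀ b c, f b c = 0 := by
  have hAt : A ≤ t := le_trans (Nat.le_mul_of_pos_right _ hB) hAB
  rw [Finset.sum_comm] at h
  have h1 : ∑ c, (∑ b, f b c * X ^ (t * (b : ℕ))) * (X - 1) ^ (t * (c : ℕ)) = 0 := by
    rw [← h]
    refine Finset.sum_congr rfl fun c _ => ?_
    rw [Finset.sum_mul]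
    refine Finset.sum_congr rfl fun b _ => ?_
    ring
  have h2 := indepX1 t C (fun c => ∑ b, f b c * X ^ (t * (b : ℕ))) ?_ ?_ h1
  · intro b c
    refine indepX t B (fun b => f b c) ?_ (h2 c) b
    intro b
    refine lt_of_le_of_lt degree_le_natDegree ?_
    exact_mod_cast (hf b c).trans_le hAt
  · intro c
    have hsub : (∑ b, f b c * X ^ (t * (b : ℕ))).support ⊆
        Finset.univ.biUnion fun b : Fin B => (Finset.range A).image (fun i => i + t * (b : ℕ)) := by
      intro i hi
      rw [mem_support_iff, finsetSum_coeff] at hi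
      obtain ⟨b, _, hb⟩ := Finset.exists_ne_zero_of_sum_ne_zero hi
      rw [coeff_mul_X_pow'] at hb
      split_ifs at hb with hle
      · rw [Finset.mem_biUnion]
        refine ⟨b, Finset.mem_univ _, Finset.mem_image.2 ⟨i - t * b, ?_, by omega⟩⟩
        rw [Finset.mem_range]
        exact (le_natDegree_of_ne_zero hb).trans_lt (hf b c)
      · exact absurd rfl hb
    refine (Finset.card_le_card hsub).trans (Finset.card_biUnion_le.trans ?_)
    refine (Finset.sum_le_card_nsmul _ _ A fun b _ => Finset.card_image_le.trans (by simp)).trans ?_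
    simpa [mul_comm] using hAB
  · intro c
    refine lt_of_lt_of_le (b := t * B) ?_ htB
    refine lt_of_le_of_lt (natDegree_sum_le_of_forall_le (n := t * B - 1) _ _ ?_) ?_
    · intro b _
      refine natDegree_mul_le.trans ?_
      rw [natDegree_X_pow]
      have := hf b c
      have hb : t * ((b : ℕ) + 1) ≤ t * B := Nat.mul_le_mul_left _ b.2
      rw [mul_add] at hb
      omega
    · have : 0 < t * B := Nat.mul_pos (by omega) hB
      omega

noncomputable def th : Module.End (ZMod p) (ZMod p)[X] :=
  (LinearMap.mulLeft (ZMod p) (X * (X - 1))).comp derivative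

noncomputable def sop (e : (ZMod p)[X]) : Module.End (ZMod p) (ZMod p)[X] :=
  th + LinearMap.mulLeft (ZMod p) e

lemma th_apply (f : (ZMod p)[X]) : th f = X * (X - 1) * derivative f := rfl
lemma sop_apply (e f : (ZMod p)[X]) : sop e f = X * (X - 1) * derivative f + e * f := rfl

lemma conj_pow (e W : (ZMod p)[X]) (h : th W = e * W) (n : ℕ) : ∀ f,
    (th ^ n) (f * W) = (sop e ^ n) f * W := by
  induction n with
  | zero => intro f; simp
  | succ n ih =>
    intro f
    rw [pow_succ, pow_succ, Module.End.mul_apply, Module.End.mul_apply, ← ih]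
    congr 1
    rw [th_apply] at h
    rw [th_apply, sop_apply, derivative_mul]
    linear_combination f * h

noncomputable def ee (m k : ℕ) : (ZMod p)[X] := C (m : ZMod p) * (X - 1) + C (k : ZMod p) * X

lemma th_W (m k : ℕ) : th (X ^ m * (X - 1) ^ k : (ZMod p)[X]) = ee m k * (X ^ m * (X - 1) ^ k) := by
  have h1 : (X : (ZMod p)[X]) * derivative (X ^ m) = C (m : ZMod p) * X ^ m := by
    rw [derivative_X_pow]
    cases m with
    | zero => simp
    | succ m => simp only [Nat.add_sub_cancel]; ring
  have h2 : (X - 1 : (ZMod p)[X]) * derivative ((X - 1) ^ k) = C (k : ZMod p) * (X - 1) ^ k := by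
    rw [derivative_pow]
    cases k with
    | zero => simp
    | succ m => simp only [Nat.add_sub_cancel, derivative_sub, derivative_X, derivative_one]; ring
  rw [th_apply, derivative_mul, ee]
  linear_combination ((X - 1) * (X - 1) ^ k) * h1 + X * X ^ m * h2

lemma natDegree_sop (m k d : ℕ) (f : (ZMod p)[X]) (hf : f.natDegree ≤ d) :
    (sop (ee m k) f).natDegree ≤ d + 1 := by
  rw [sop_apply]
  refine natDegree_add_le_of_degree_le ?_ ?_
  · rcases Nat.eq_zero_or_pos d with rfl | hd
    · rw [derivative_of_natDegree_zero (by omega)]; simp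
    · have h1 := natDegree_derivative_le f
      have h2 : (X * (X - 1) : (ZMod p)[X]).natDegree ≤ 2 := by compute_degree
      refine natDegree_mul_le.trans ?_
      omega
  · have h2 : (ee m k : (ZMod p)[X]).natDegree ≤ 1 := by unfold ee; compute_degree
    refine natDegree_mul_le.trans ?_
    omega

lemma natDegree_sop_pow (m k n : ℕ) : ∀ (d : ℕ) (f : (ZMod p)[X]), f.natDegree ≤ d →
    ((sop (ee m k) ^ n) f).natDegree ≤ d + n := by
  induction n with
  | zero => intro d f hf; simpa using hf
  | succ n ih =>
    intro d f hf
    rw [pow_succ, Module.End.mul_apply]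
    have := ih (d+1) _ (natDegree_sop m k d f hf)
    omega

lemma mult (x : ZMod p) (hx0 : x ≠ 0) (hx1 : x ≠ 1) (D : ℕ) : ∀ (f : (ZMod p)[X]), D ≤ p →
    (∀ n < D, ((th ^ n) f).eval x = 0) → (X - C x) ^ D ∣ f := by
  induction D with
  | zero => intro f _ _; simp
  | succ D ih =>
    intro f hD h
    have h1 : (X - C x) ^ D ∣ th f := by
      apply ih _ (by omega)
      intro n hn
      have := h (n+1) (by omega)
      rwa [pow_succ, Module.End.mul_apply] at this
    have h0 : f.IsRoot x := by simpa using h 0 (by omega)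
    rw [th_apply] at h1
    have hcop : IsCoprime ((X - C x) ^ D) (X * (X - 1) : (ZMod p)[X]) := by
      apply IsCoprime.pow_left
      apply IsCoprime.mul_right
      · have := isCoprime_X_sub_C_of_isUnit_sub (R := ZMod p) (a := x) (b := 0) (by simpa using hx0)
        simpa using this
      · have := isCoprime_X_sub_C_of_isUnit_sub (R := ZMod p) (a := x) (b := 1)
          (by simpa [sub_eq_zero] using hx1)
        simpa using this
    have h2 := hcop.dvd_of_dvd_mul_left h1
    by_cases hf : f = 0
    · simp [hf]
    rw [← le_rootMultiplicity_iff hf]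
    by_contra hlt
    push Not at hlt
    have hpos := (rootMultiplicity_pos hf).2 h0
    have hne : ((f.rootMultiplicity x : ℕ) : ZMod p) ≠ 0 := by
      rw [Ne, ZMod.natCast_eq_zero_iff]
      intro hdv
      have := Nat.le_of_dvd hpos hdv
      omega
    have h3 := derivative_rootMultiplicity_of_root_of_mem_nonZeroDivisors h0
      (mem_nonZeroDivisors_of_ne_zero hne)
    by_cases hf' : derivative f = 0
    · obtain ⟨q, hq, hnd⟩ := exists_eq_pow_rootMultiplicity_mul_and_not_dvd f hf x
      obtain ⟨m, hm⟩ : ∃ m, f.rootMultiplicity x = m + 1 := ⟨_, (Nat.succ_pred_eq_of_pos hpos).symm⟩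
      rw [hm] at hq hne
      apply hnd
      rw [hq, derivative_mul, derivative_X_sub_C_pow] at hf'
      simp only [Nat.add_sub_cancel] at hf'
      have h5 : (X - C x) ^ m * (C ((m + 1 : ℕ) : ZMod p) * q + (X - C x) * derivative q) = 0 := by
        rw [← hf']; ring
      have h6 := (mul_eq_zero.1 h5).resolve_left (pow_ne_zero _ (X_sub_C_ne_zero x))
      have h7 : X - C x ∣ C ((m + 1 : ℕ) : ZMod p) * q := by
        rw [eq_neg_of_add_eq_zero_left h6]
        exact (dvd_mul_right _ _).neg_right
      refine (IsUnit.dvd_mul_left ?_).1 h7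
      exact (isUnit_C.2 (isUnit_iff_ne_zero.2 hne))
    · have h4 := (le_rootMultiplicity_iff hf').2 h2
      omega

noncomputable def lmap (t A B E D : ℕ) (Q : Finset (ZMod p)) :
    (Fin B → Fin E → degreeLT (ZMod p) A) →ₗ[ZMod p] (Fin D → Q → Fin (A + D) → ZMod p) :=
  { toFun := fun v n ν i => (∑ b : Fin B, ∑ c : Fin E, ((ν : ZMod p) ^ (c : ℕ)) •
        (sop (ee (t * b) (t * c)) ^ (n : ℕ)) (v b c : (ZMod p)[X])).coeff (i : ℕ)
    map_add' := by
      intro v w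
      funext n ν i
      simp only [Pi.add_apply, Submodule.coe_add, map_add, smul_add, Finset.sum_add_distrib,
        coeff_add]
    map_smul' := by
      intro a v
      funext n ν i
      simp only [Pi.smul_apply, Submodule.coe_smul, map_smul, RingHom.id_apply, smul_eq_mul]
      simp only [smul_comm _ a, ← Finset.smul_sum, coeff_smul, smul_eq_mul] }

lemma lmap_apply (t A B E D : ℕ) (Q : Finset (ZMod p)) (v n ν i) :
    lmap t A B E D Q v n ν i = (∑ b : Fin B, ∑ c : Fin E, ((ν : ZMod p) ^ (c : ℕ)) •
        (sop (ee (t * b) (t * c)) ^ (n : ℕ)) (v b c : (ZMod p)[X])).coeff (i : ℕ) := rfl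

lemma key (t A B E D : ℕ) (hA : 0 < A) (hB : 0 < B) (hAB : A * B ≤ t) (htB : t * B ≤ p)
    (hD : D ≤ p) (Q : Finset (ZMod p)) (hcount : D * (Q.card * (A + D)) < B * (E * A))
    (S : Finset (ZMod p)) (hS : ∀ x ∈ S, x ≠ 0 ∧ x ≠ 1 ∧ x ^ t = 1 ∧ (x - 1) ^ t ∈ Q) :
    D * S.card ≤ A + t * B + t * E := by
  have hfin : Module.finrank (ZMod p) (Fin D → Q → Fin (A + D) → ZMod p)
      < Module.finrank (ZMod p) (Fin B → Fin E → degreeLT (ZMod p) A) := by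
    have h1 : Module.finrank (ZMod p) (degreeLT (ZMod p) A) = A := by
      rw [(degreeLTEquiv (ZMod p) A).finrank_eq]; simp
    have : Module.Finite (ZMod p) (degreeLT (ZMod p) A) :=
      Module.Finite.equiv (degreeLTEquiv (ZMod p) A).symm
    simp only [Module.finrank_pi_fintype, h1, Finset.sum_const, Finset.card_univ, Fintype.card_fin,
      smul_eq_mul, Module.finrank_self, mul_one, Fintype.card_coe]
    exact hcount
  have : Module.Finite (ZMod p) (degreeLT (ZMod p) A) :=
      Module.Finite.equiv (degreeLTEquiv (ZMod p) A).symm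
  obtain ⟨v, hv, hv0⟩ := Submodule.exists_mem_ne_zero_of_ne_bot
    (LinearMap.ker_ne_bot_of_finrank_lt (f := lmap t A B E D Q) hfin)
  rw [LinearMap.mem_ker] at hv
  have hdeg : ∀ b c, (v b c : (ZMod p)[X]).natDegree ≤ A - 1 := by
    intro b c
    have h := mem_degreeLT.1 (v b c).2
    by_cases h0 : (v b c : (ZMod p)[X]) = 0
    · rw [h0]; simp
    · have := (natDegree_lt_iff_degree_lt h0).2 h
      omega
  have hpoly : ∀ n < D, ∀ ν ∈ Q, ∑ b : Fin B, ∑ c : Fin E, (ν ^ (c : ℕ)) •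
        (sop (ee (t * b) (t * c)) ^ n) (v b c : (ZMod p)[X]) = 0 := by
    intro n hn ν hν
    ext i
    rw [coeff_zero]
    by_cases hi : i < A + D
    · rw [← lmap_apply t A B E D Q v ⟨n, hn⟩ ⟨ν, hν⟩ ⟨i, hi⟩, hv]; rfl
    · apply coeff_eq_zero_of_natDegree_lt
      refine lt_of_le_of_lt (natDegree_sum_le_of_forall_le (n := A - 1 + n) _ _ ?_) (by omega)
      intro b _
      refine natDegree_sum_le_of_forall_le _ _ ?_
      intro c _
      exact (natDegree_smul_le _ _).trans (natDegree_sop_pow _ _ _ _ _ (hdeg b c))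
  set Ψ : (ZMod p)[X] := ∑ b : Fin B, ∑ c : Fin E, (v b c : (ZMod p)[X]) *
    (X ^ (t * (b : ℕ)) * (X - 1) ^ (t * (c : ℕ))) with hΨ
  have hΨ0 : Ψ ≠ 0 := by
    intro h0
    apply hv0
    have := indep t A B E hA hB hAB htB (fun b c => (v b c : (ZMod p)[X]))
      (fun b c => by have := hdeg b c; show (v b c : (ZMod p)[X]).natDegree < A; omega) h0
    funext b c
    exact Subtype.ext (this b c)
  have hroot : ∀ x ∈ S, D ≤ Ψ.roots.count x := by
    intro x hx
    obtain ⟨hx0, hx1, hxt, hxQ⟩ := hS x hx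
    rw [count_roots, le_rootMultiplicity_iff hΨ0]
    apply mult x hx0 hx1 D _ hD
    intro n hn
    have h := congrArg (eval x) (hpoly n hn _ hxQ)
    rw [eval_zero] at h
    rw [← h, hΨ]
    simp only [map_sum, eval_finsetSum]
    refine Finset.sum_congr rfl fun b _ => Finset.sum_congr rfl fun c _ => ?_
    rw [conj_pow _ _ (th_W _ _)]
    simp only [eval_mul, eval_pow, eval_X, eval_sub, eval_one, eval_smul, smul_eq_mul]
    rw [pow_mul, hxt, one_pow, pow_mul]
    ring
  have hle : D * S.card ≤ Ψ.natDegree := by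
    refine le_trans ?_ (card_roots' Ψ)
    have h1 : D • S.val ≤ Ψ.roots := by
      rw [Multiset.le_iff_count]
      intro x
      rw [Multiset.count_nsmul]
      by_cases hx : x ∈ S
      · rw [Multiset.count_eq_one_of_mem S.nodup hx, mul_one]
        exact hroot x hx
      · rw [Multiset.count_eq_zero_of_notMem hx]; simp
    have := Multiset.card_le_card h1
    simpa using this
  refine hle.trans ?_
  refine natDegree_sum_le_of_forall_le _ _ fun b _ => natDegree_sum_le_of_forall_le _ _ fun c _ => ?_
  have e1 : (X ^ (t * (b : ℕ)) : (ZMod p)[X]).natDegree ≤ t * B := by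
    rw [natDegree_X_pow]; exact Nat.mul_le_mul_left _ b.2.le
  have e2 : ((X - 1) ^ (t * (c : ℕ)) : (ZMod p)[X]).natDegree ≤ t * E := by
    rw [← C_1, natDegree_pow, natDegree_X_sub_C, mul_one]; exact Nat.mul_le_mul_left _ c.2.le
  have e3 := hdeg b c
  have e4 := natDegree_mul_le (p := (v b c : (ZMod p)[X]))
    (q := X ^ (t * (b : ℕ)) * (X - 1) ^ (t * (c : ℕ)))
  have e5 := natDegree_mul_le (p := (X ^ (t * (b : ℕ)) : (ZMod p)[X]))
    (q := (X - 1) ^ (t * (c : ℕ)))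
  omega

lemma key2 (t : ℕ) (ht : 16 ≤ t) (htp : 27 * t ^ 3 ≤ p ^ 2) (htp' : t ≤ p)
    (Q : Finset (ZMod p)) (hQ0 : 0 < Q.card) (hQ : Q.card ^ 2 ≤ t)
    (S : Finset (ZMod p)) (hS : ∀ x ∈ S, x ≠ 0 ∧ x ≠ 1 ∧ x ^ t = 1 ∧ (x - 1) ^ t ∈ Q) :
    S.card ^ 3 ≤ 512000 * Q.card ^ 2 * t ^ 2 := by
  set J := Q.card with hJ
  have hex : ∃ B : ℕ, 8 * J * t ≤ B ^ 3 :=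
    ⟨8 * J * t, Nat.le_self_pow (by norm_num) _⟩
  obtain ⟨B, hB1, hB2⟩ : ∃ B : ℕ, 8 * J * t ≤ B ^ 3 ∧ ∀ m < B, m ^ 3 < 8 * J * t :=
    ⟨Nat.find hex, Nat.find_spec hex, fun m hm => not_le.1 (Nat.find_min hex hm)⟩
  have hJt : 16 ≤ J * t := by nlinarith
  have hBge : 2 ≤ B := by
    by_contra h
    have : B ≤ 1 := by omega
    have : B ^ 3 ≤ 1 ^ 3 := Nat.pow_le_pow_left this 3
    nlinarith
  have hB3 : B ^ 3 < 64 * (J * t) := by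
    have h1 := hB2 (B - 1) (by omega)
    have h2 : B ^ 3 ≤ (2 * (B - 1)) ^ 3 := Nat.pow_le_pow_left (by omega) 3
    rw [mul_pow] at h2
    nlinarith
  have hB6 : B ^ 6 < 4096 * (J ^ 2 * t ^ 2) := by
    calc B ^ 6 = (B ^ 3) ^ 2 := by ring
      _ < (64 * (J * t)) ^ 2 := Nat.pow_lt_pow_left hB3 (by norm_num)
      _ = _ := by ring
  have hB2t : B ^ 2 < 16 * t := by
    by_contra h
    push Not at h
    have h1 : (16 * t) ^ 3 ≤ (B ^ 2) ^ 3 := Nat.pow_le_pow_left h 3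
    have h2 : J ^ 2 * t ^ 2 ≤ t * t ^ 2 := Nat.mul_le_mul_right _ hQ
    nlinarith
  have hBt : B ≤ t := by
    by_contra h
    push Not at h
    nlinarith
  set A := t / B with hA
  have hB0 : 0 < B := by omega
  have hA0 : 0 < A := Nat.div_pos hBt hB0
  have hAB : A * B ≤ t := Nat.div_mul_le_self t B
  have hAB2 : t ≤ 2 * (A * B) := by
    have : t < (A + 1) * B := by
      have := Nat.lt_div_mul_add (a := t) hB0
      rw [add_mul, one_mul]; exact this
    nlinarith
  have htB : t * B ≤ p := by
    have : (t * B) ^ 2 ≤ p ^ 2 := by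
      have : t ^ 2 * B ^ 2 ≤ t ^ 2 * (16 * t) := Nat.mul_le_mul_left _ hB2t.le
      nlinarith
    exact (Nat.pow_le_pow_iff_left (by norm_num)).1 this
  have hAt : A ≤ t := Nat.div_le_self _ _
  have hc : A * (J * (A + A)) < B * (B * A) := by
    have h1 : 2 * J * (A * B) ≤ 2 * J * t := Nat.mul_le_mul_left _ hAB
    have h2 : 2 * J * A < B ^ 2 := by
      by_contra h
      push Not at h
      have : B ^ 2 * B ≤ 2 * J * A * B := Nat.mul_le_mul_right _ h
      nlinarith
    nlinarith
  have hk := key t A B B A hA0 hB0 hAB htB (hAt.trans htp') Q hc S hS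
  have hS5 : S.card ≤ 5 * B ^ 2 := by
    have h1 : t * B ≤ 2 * (A * B) * B := Nat.mul_le_mul_right _ hAB2
    have h2 : A * S.card ≤ A * (5 * B ^ 2) := by
      have : A * 1 ≤ A * B ^ 2 := Nat.mul_le_mul_left _ (Nat.one_le_pow _ _ hB0)
      nlinarith
    exact Nat.le_of_mul_le_mul_left h2 hA0
  calc S.card ^ 3 ≤ (5 * B ^ 2) ^ 3 := Nat.pow_le_pow_left hS5 3
    _ = 125 * B ^ 6 := by ring
    _ ≤ 512000 * J ^ 2 * t ^ 2 := by nlinarith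

end HBK

namespace HBK

lemma sq_le_sum (u : ℕ) : ∀ n, u ≤ n → n ^ 2 ≤ u ^ 2 + ∑ τ ∈ Finset.Ioc u n, 2 * τ := by
  intro n hn
  induction n, hn using Nat.le_induction with
  | base => simp
  | succ n hn ih =>
    rw [Finset.sum_Ioc_succ_top (by omega)]
    nlinarith

lemma levels {ι : Type*} [Fintype ι] [DecidableEq ι] (N : ι → ℕ) (t : ℕ) (ht : 16 ≤ t)
    (hsum : ∑ i, N i ≤ t)
    (h : ∀ Q : Finset ι, 0 < Q.card → Q.card ^ 2 ≤ t →
      (∑ i ∈ Q, N i) ^ 3 ≤ 512000 * Q.card ^ 2 * t ^ 2) :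
    ((∑ i, N i ^ 2 : ℕ) : ℝ) ≤ 60000 * √(t : ℝ) ^ 3 := by
  set r := Nat.sqrt t with hr
  have hr1 : r ^ 2 ≤ t := Nat.sqrt_le' t
  have hr2 : t < (r + 1) ^ 2 := Nat.lt_succ_sqrt' t
  have hr3 : 2 ≤ r := by
    by_contra hh
    have : r ≤ 1 := by omega
    have : (r + 1) ^ 2 ≤ 2 ^ 2 := Nat.pow_le_pow_left (by omega) 2
    omega
  set u := 100 * (r + 1) with hu
  let Qs : ℕ → Finset ι := fun τ => Finset.univ.filter fun i => τ ≤ N i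
  have hsub : ∀ τ, ∀ Q ⊆ Qs τ, Q.card ≤ r → τ ^ 3 * Q.card ≤ 512000 * t ^ 2 := by
    intro τ Q hQ hc
    rcases Nat.eq_zero_or_pos Q.card with h0 | hpos
    · rw [h0]; simp
    have h1 := h Q hpos ((Nat.pow_le_pow_left hc 2).trans hr1)
    have h2 : Q.card * τ ≤ ∑ i ∈ Q, N i := by
      rw [← smul_eq_mul]
      exact Finset.card_nsmul_le_sum _ _ _ fun i hi => (Finset.mem_filter.1 (hQ hi)).2
    have h3 := (Nat.pow_le_pow_left h2 3).trans h1
    have h4 : Q.card ^ 2 * (τ ^ 3 * Q.card) ≤ Q.card ^ 2 * (512000 * t ^ 2) := by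
      calc _ = (Q.card * τ) ^ 3 := by ring
        _ ≤ _ := h3
        _ = _ := by ring
    exact Nat.le_of_mul_le_mul_left h4 (by positivity)
  have hcard : ∀ τ, u ≤ τ → (Qs τ).card ≤ r := by
    intro τ hτ
    by_contra hlt
    push Not at hlt
    obtain ⟨Q, hQ, hQc⟩ := Finset.exists_subset_card_eq hlt.le
    have h1 := hsub τ Q hQ hQc.le
    rw [hQc] at h1
    have h2 : u ^ 3 * r ≤ τ ^ 3 * r := Nat.mul_le_mul_right _ (Nat.pow_le_pow_left hτ 3)
    have h3 : t ^ 2 ≤ ((r + 1) ^ 2) ^ 2 := Nat.pow_le_pow_left hr2.le 2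
    have h4 : (r + 1) ^ 3 * (1000000 * r) ≤ (r + 1) ^ 3 * (512000 * (r + 1)) := by
      calc _ = u ^ 3 * r := by rw [hu]; ring
        _ ≤ 512000 * t ^ 2 := h2.trans h1
        _ ≤ 512000 * ((r + 1) ^ 2) ^ 2 := Nat.mul_le_mul_left _ h3
        _ = _ := by ring
    have h5 := Nat.le_of_mul_le_mul_left h4 (by positivity)
    omega
  have hNt : ∀ i, N i ≤ t := fun i =>
    (Finset.single_le_sum (fun j _ => Nat.zero_le (N j)) (Finset.mem_univ i)).trans hsum
  have hpt : ∀ i, N i ^ 2 ≤ u * N i + (if u ≤ N i then u ^ 2 else 0) +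
      ∑ τ ∈ Finset.Ioc u t, if τ ≤ N i then 2 * τ else 0 := by
    intro i
    by_cases hi : u ≤ N i
    · have h1 := sq_le_sum u _ hi
      rw [if_pos hi, ← Finset.sum_filter]
      have h2 : (Finset.Ioc u t).filter (fun τ => τ ≤ N i) = Finset.Ioc u (N i) := by
        ext τ
        have := hNt i
        simp only [Finset.mem_filter, Finset.mem_Ioc]
        omega
      rw [h2]
      omega
    · push Not at hi
      have : N i ^ 2 ≤ u * N i := by rw [pow_two]; exact Nat.mul_le_mul_right _ hi.le
      omega
  have hT : ∑ i, N i ^ 2 ≤ u * t + u ^ 2 * r + ∑ τ ∈ Finset.Ioc u t, 2 * τ * (Qs τ).card := by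
    refine (Finset.sum_le_sum fun i _ => hpt i).trans ?_
    rw [Finset.sum_add_distrib, Finset.sum_add_distrib, ← Finset.mul_sum]
    refine Nat.add_le_add (Nat.add_le_add (Nat.mul_le_mul_left _ hsum) ?_) ?_
    · rw [← Finset.sum_filter, Finset.sum_const, smul_eq_mul, mul_comm]
      exact Nat.mul_le_mul_left _ (hcard u le_rfl)
    · rw [Finset.sum_comm]
      refine Finset.sum_le_sum fun τ _ => ?_
      rw [← Finset.sum_filter, Finset.sum_const, smul_eq_mul, mul_comm]
  have hs0 : 0 < √(t : ℝ) := Real.sqrt_pos.2 (by exact_mod_cast (by omega : 0 < t))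
  have hst : √(t : ℝ) ^ 2 = t := Real.sq_sqrt (Nat.cast_nonneg _)
  set s := √(t : ℝ) with hs
  have hrs : (r : ℝ) ≤ s := by
    apply Real.le_sqrt_of_sq_le
    exact_mod_cast hr1
  have hsr : s ≤ r + 1 := by
    apply Real.sqrt_le_iff.2
    refine ⟨by positivity, by exact_mod_cast hr2.le⟩
  have hr3' : (2 : ℝ) ≤ r := by exact_mod_cast hr3
  have hu' : (u : ℝ) = 100 * (r + 1) := by rw [hu]; push_cast; ring
  have hu1 : (u : ℝ) ≤ 200 * s := by linarith
  have hu2 : 100 * s ≤ u := by linarith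
  have htail : ∑ τ ∈ Finset.Ioc u t, (2 * τ * (Qs τ).card : ℝ) ≤ 1024000 * s ^ 4 * (u : ℝ)⁻¹ := by
    have h1 : ∀ τ ∈ Finset.Ioc u t, (2 * τ * (Qs τ).card : ℝ)
        ≤ 1024000 * s ^ 4 * ((τ : ℝ) ^ 2)⁻¹ := by
      intro τ hτ
      rw [Finset.mem_Ioc] at hτ
      have hτ0 : (0 : ℝ) < τ := by exact_mod_cast (by omega : 0 < τ)
      have h2 : ((τ ^ 3 * (Qs τ).card : ℕ) : ℝ) ≤ ((512000 * t ^ 2 : ℕ) : ℝ) :=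
        Nat.cast_le.2 (hsub τ (Qs τ) (Finset.Subset.refl _) (hcard τ hτ.1.le))
      push_cast at h2
      rw [← div_eq_mul_inv, le_div_iff₀ (by positivity)]
      rw [← hst] at h2
      nlinarith
    refine (Finset.sum_le_sum h1).trans ?_
    rw [← Finset.mul_sum]
    refine mul_le_mul_of_nonneg_left ?_ (by positivity)
    by_cases hut : u ≤ t
    · refine (sum_Ioc_inv_sq_le_sub (by omega) hut).trans ?_
      have : (0 : ℝ) ≤ (t : ℝ)⁻¹ := by positivity
      linarith
    · rw [Finset.Ioc_eq_empty (by omega), Finset.sum_empty]; positivity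
  have htail2 : 1024000 * s ^ 4 * (u : ℝ)⁻¹ ≤ 10240 * s ^ 3 := by
    rw [← div_eq_mul_inv, div_le_iff₀ (by linarith)]
    have : 10240 * s ^ 3 * (100 * s) ≤ 10240 * s ^ 3 * u :=
      mul_le_mul_of_nonneg_left hu2 (by positivity)
    nlinarith
  have hT' : ((∑ i, N i ^ 2 : ℕ) : ℝ) ≤ u * t + u ^ 2 * r +
      ∑ τ ∈ Finset.Ioc u t, (2 * τ * (Qs τ).card : ℝ) := by
    exact_mod_cast hT
  have e1 : (u : ℝ) * t ≤ 200 * s ^ 3 := by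
    rw [← hst]
    calc (u : ℝ) * s ^ 2 ≤ 200 * s * s ^ 2 := mul_le_mul_of_nonneg_right hu1 (by positivity)
      _ = _ := by ring
  have e2 : (u : ℝ) ^ 2 * r ≤ 40000 * s ^ 3 := by
    calc (u : ℝ) ^ 2 * r ≤ (200 * s) ^ 2 * s := by gcongr
      _ = _ := by ring
  have : 0 < s ^ 3 := by positivity
  linarith

lemma energy_le {p : ℕ} [Fact p.Prime] (R : Finset (ZMod p)) (t : ℕ) (ht : R.card = t)
    (h0 : ∀ x ∈ R, x ≠ 0) (h1 : ∀ x ∈ R, x ^ t = 1) (hdiv : ∀ x ∈ R, ∀ y ∈ R, x / y ∈ R) :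
    addE R R ≤ t ^ 2 + t * ∑ ν : ZMod p, (R.filter fun x => x ≠ 1 ∧ (x - 1) ^ t = ν).card ^ 2 := by
  unfold addE
  rw [← Finset.card_filter_add_card_filter_not (fun q => q.1.1 = q.1.2)]
  refine Nat.add_le_add ?_ ?_
  · rw [← ht, pow_two, ← Finset.card_product]
    refine Finset.card_le_card_of_injOn (fun q => (q.1.1, q.2.1)) ?_ ?_
    · rintro ⟨⟨a, b⟩, c, d⟩ hq
      simp only [Finset.coe_filter, Finset.mem_filter, Finset.mem_product, Set.mem_ofPred_eq] at hq
      simp only [Finset.coe_product, Set.mem_prod, Finset.mem_coe]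
      tauto
    · rintro ⟨⟨a, b⟩, c, d⟩ hq ⟨⟨a', b'⟩, c', d'⟩ hq' he
      simp only [Finset.coe_filter, Finset.mem_filter, Finset.mem_product, Set.mem_ofPred_eq] at hq hq'
      obtain ⟨⟨_, hq1⟩, rfl⟩ := hq
      obtain ⟨⟨_, hq1'⟩, rfl⟩ := hq'
      simp only [Prod.mk.injEq] at he
      obtain ⟨rfl, rfl⟩ := he
      rw [add_right_inj] at hq1 hq1'
      rw [← hq1, ← hq1']
  · have hc : (Finset.univ.sigma fun ν : ZMod p =>
        (R.filter fun x => x ≠ 1 ∧ (x - 1) ^ t = ν) ×ˢ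
        (R.filter fun x => x ≠ 1 ∧ (x - 1) ^ t = ν)).card =
        ∑ ν : ZMod p, (R.filter fun x => x ≠ 1 ∧ (x - 1) ^ t = ν).card ^ 2 := by
      rw [Finset.card_sigma]
      refine Finset.sum_congr rfl fun ν _ => ?_
      rw [Finset.card_product, pow_two]
    rw [← hc]
    refine le_trans ?_ (le_of_eq ((Finset.card_product R _).trans (congrArg (· * _) ht)))
    refine Finset.card_le_card_of_injOn
      (fun q => (q.1.2, ⟨(q.1.1 / q.1.2 - 1) ^ t, (q.1.1 / q.1.2, q.2.2 / q.2.1)⟩)) ?_ ?_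
    · rintro ⟨⟨a, b⟩, c, d⟩ hq
      simp only [Finset.coe_filter, Finset.mem_filter, Finset.mem_product, Set.mem_ofPred_eq] at hq
      obtain ⟨⟨⟨⟨ha, hb⟩, hcR, hd⟩, he⟩, hne⟩ := hq
      simp only [Finset.coe_product, Set.mem_prod, Finset.mem_coe, Finset.mem_sigma,
        Finset.mem_univ, Finset.mem_product, Finset.mem_filter, true_and]
      have hb0 := h0 b hb
      have hc0 := h0 c hcR
      have hab : a / b ≠ 1 := by rwa [Ne, div_eq_one_iff_eq hb0]
      have hdc : d / c ≠ 1 := by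
        rw [Ne, div_eq_one_iff_eq hc0]
        rintro rfl
        exact hne (add_right_cancel he)
      refine ⟨hb, ⟨hdiv a ha b hb, hab, trivial⟩, hdiv d hd c hcR, hdc, ?_⟩
      have h3 : b * (a / b - 1) = c * (d / c - 1) := by
        field_simp
        linear_combination he
      have h4 := congrArg (· ^ t) h3
      simp only [mul_pow, h1 b hb, h1 c hcR, one_mul] at h4
      exact h4.symm
    · rintro ⟨⟨a, b⟩, c, d⟩ hq ⟨⟨a', b'⟩, c', d'⟩ hq' hh
      simp only [Finset.coe_filter, Finset.mem_filter, Finset.mem_product, Set.mem_ofPred_eq] at hq hq'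
      obtain ⟨⟨⟨⟨ha, hb⟩, hcR, hd⟩, he⟩, hne⟩ := hq
      obtain ⟨⟨⟨⟨ha', hb'⟩, hcR', hd'⟩, he'⟩, hne'⟩ := hq'
      simp only [Prod.mk.injEq, Sigma.mk.injEq, heq_eq_eq] at hh
      obtain ⟨rfl, _, h2, h3⟩ := hh
      have hb0 := h0 b hb
      have hc0 := h0 c hcR
      have hc0' := h0 c' hcR'
      rw [div_left_inj' hb0] at h2
      subst h2
      have hdc : d / c ≠ 1 := by
        rw [Ne, div_eq_one_iff_eq hc0]
        rintro rfl
        exact hne (add_right_cancel he)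
      have e1 : c * (d / c - 1) = c' * (d / c - 1) := by
        nth_rewrite 2 [h3]
        field_simp
        linear_combination he' - he
      have e2 : c = c' := mul_right_cancel₀ (sub_ne_zero.2 hdc) e1
      subst e2
      rw [div_left_inj' hc0] at h3
      rw [h3]

lemma main {p : ℕ} [Fact p.Prime] (R : Finset (ZMod p)) (t : ℕ) (ht : R.card = t) (hpos : 0 < t)
    (h0 : ∀ x ∈ R, x ≠ 0) (h1 : ∀ x ∈ R, x ^ t = 1) (hdiv : ∀ x ∈ R, ∀ y ∈ R, x / y ∈ R)
    (htp : 27 * t ^ 3 ≤ p ^ 2) : (addE R R : ℝ) ≤ 60001 * √(t : ℝ) ^ 5 := by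
  have htp' : t ≤ p := by
    rw [← ht]
    simpa [ZMod.card] using Finset.card_le_univ R
  have hE := energy_le R t ht h0 h1 hdiv
  set N : ZMod p → ℕ := fun ν => (R.filter fun x => x ≠ 1 ∧ (x - 1) ^ t = ν).card with hN
  have hQsum : ∀ Q : Finset (ZMod p), ∑ ν ∈ Q, N ν =
      (R.filter fun x => x ≠ 1 ∧ (x - 1) ^ t ∈ Q).card := by
    intro Q
    rw [Finset.card_eq_sum_card_fiberwise (f := fun x => (x - 1) ^ t) (t := Q)]
    · refine Finset.sum_congr rfl fun ν hν => ?_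
      rw [hN, Finset.filter_filter]
      refine congrArg Finset.card ?_
      ext x
      simp only [Finset.mem_filter]
      constructor
      · rintro ⟨a, b, rfl⟩; exact ⟨a, ⟨b, hν⟩, rfl⟩
      · rintro ⟨a, ⟨b, _⟩, c⟩; exact ⟨a, b, c⟩
    · intro x hx
      simp only [Finset.coe_filter, Set.mem_ofPred_eq] at hx
      exact hx.2.2
  have hsum : ∑ ν, N ν ≤ t := by
    rw [hQsum, ← ht]
    exact Finset.card_filter_le _ _
  have hs1 : 1 ≤ √(t : ℝ) := by
    rw [Real.one_le_sqrt]; exact_mod_cast hpos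
  have hst : √(t : ℝ) ^ 2 = t := Real.sq_sqrt (Nat.cast_nonneg _)
  have hT : ((∑ ν, N ν ^ 2 : ℕ) : ℝ) ≤ 60000 * √(t : ℝ) ^ 3 := by
    rcases le_or_gt 16 t with h16 | h16
    · refine levels N t h16 hsum ?_
      intro Q hQ0 hQ
      rw [hQsum]
      refine key2 t h16 htp htp' Q hQ0 hQ _ ?_
      intro x hx
      rw [Finset.mem_filter] at hx
      exact ⟨h0 x hx.1, hx.2.1, h1 x hx.1, hx.2.2⟩
    · have h2 : ∑ ν, N ν ^ 2 ≤ t ^ 2 := by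
        refine le_trans ?_ (Nat.pow_le_pow_left hsum 2)
        exact Finset.sum_sq_le_sq_sum_of_nonneg fun i _ => Nat.zero_le _
      have h3 : t ^ 2 ≤ 16 * t := by nlinarith
      have h4 : ((∑ ν, N ν ^ 2 : ℕ) : ℝ) ≤ 16 * t := by exact_mod_cast h2.trans h3
      rw [← hst] at h4
      have : √(t : ℝ) ^ 2 * 1 ≤ √(t : ℝ) ^ 2 * √(t : ℝ) := by gcongr
      have h5 : 0 ≤ √(t : ℝ) ^ 2 * √(t : ℝ) := by positivity
      calc _ ≤ _ := h4
        _ ≤ 60000 * (√(t : ℝ) ^ 2 * √(t : ℝ)) := by linarith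
        _ = _ := by ring
  have hE' : (addE R R : ℝ) ≤ (t : ℝ) ^ 2 + t * ((∑ ν, N ν ^ 2 : ℕ) : ℝ) := by exact_mod_cast hE
  set s := √(t : ℝ)
  rw [← hst] at hE'
  have e1 : s ^ 2 * ((∑ ν, N ν ^ 2 : ℕ) : ℝ) ≤ s ^ 2 * (60000 * s ^ 3) := by gcongr
  have e2 : s ^ 4 * 1 ≤ s ^ 4 * s := by gcongr
  nlinarith

end HBK

theorem subgroup_energy_bound :
    ∃ c C : ℝ, 0 < c ∧ 0 < C ∧
      ∀ p : ℕ, p.Prime →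
        ∀ R : Finset (ZMod p), IsMulSubgroup p R →
          (R.card : ℝ) ≤ c * (p : ℝ) ^ ((2 : ℝ) / 3) →
          (addE R R : ℝ) ≤ C * (R.card : ℝ) ^ ((5 : ℝ) / 2) := by
  refine ⟨1 / 3, 60001, by norm_num, by norm_num, ?_⟩
  intro p hp R hR hcard
  have : Fact p.Prime := ⟨hp⟩
  obtain ⟨H, hH⟩ := hR
  have hmem : ∀ x, x ∈ R ↔ ∃ h ∈ H, (h : ZMod p) = x := by
    intro x
    rw [← Finset.mem_coe, hH]
    simp
  have hRH : R.card = Nat.card H := by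
    rw [← Set.ncard_coe_finset, hH, Set.ncard_image_of_injective _ Units.val_injective]
    rfl
  have hpow : (R.card : ℝ) ^ ((5 : ℝ) / 2) = √(R.card : ℝ) ^ 5 := by
    rw [Real.sqrt_eq_rpow, ← Real.rpow_natCast, ← Real.rpow_mul (Nat.cast_nonneg _)]
    norm_num
  rw [hpow]
  refine HBK.main R R.card rfl ?_ ?_ ?_ ?_ ?_
  · exact Finset.card_pos.2 ⟨1, (hmem 1).2 ⟨1, H.one_mem, by simp⟩⟩
  · intro x hx
    obtain ⟨h, _, rfl⟩ := (hmem x).1 hx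
    exact h.ne_zero
  · intro x hx
    obtain ⟨h, hh, rfl⟩ := (hmem x).1 hx
    rw [hRH]
    have : (⟨h, hh⟩ : H) ^ Nat.card H = 1 := pow_card_eq_one'
    have h2 : h ^ Nat.card H = 1 := congrArg Subtype.val this
    rw [← Units.val_pow_eq_pow_val, h2, Units.val_one]
  · intro x hx y hy
    obtain ⟨h, hh, rfl⟩ := (hmem x).1 hx
    obtain ⟨k, hk, rfl⟩ := (hmem y).1 hy
    exact (hmem _).2 ⟨h / k, H.div_mem hh hk, by simp [Units.val_div_eq_div_val]⟩
  · have h3 := pow_le_pow_left₀ (Nat.cast_nonneg _) hcard 3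
    rw [mul_pow, ← Real.rpow_natCast ((p : ℝ) ^ ((2 : ℝ) / 3)) 3,
      ← Real.rpow_mul (Nat.cast_nonneg _)] at h3
    have e : (2 : ℝ) / 3 * (3 : ℕ) = (2 : ℕ) := by norm_num
    rw [e, Real.rpow_natCast] at h3
    have : (27 : ℝ) * (R.card : ℝ) ^ 3 ≤ (p : ℝ) ^ 2 := by linarith
    exact_mod_cast this
end
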